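/- arXiv:2211.06033 — 12 statements merged into one kernel-verified Lean document; each statement's English description precedes it below -/
import Mathlib

section
/- Let G be a finite simple graph and T a rooted tree on the vertex set V(G) with the property that for every path v_1,…,v_k in G there exists some i ∈ {1,…,k} such that v_i is a weak ancestor in T of both v_1 and v_k. Let π : V(G) → {1,…,|V(G)|} be any bijection with π(u) < π(v) whenever u is a proper descendant of v in T (for example, any post-order traversal of T). Then for every vertex v and every path v = v_1,…,v_k = u in G with π(v_i) ≤ π(v) for all i < k, the vertices u and v are comparable in T; in particular, if π(u) > π(v) then u is a proper ancestor of v and hence π(u) ≥ π(p), where p is the parent of v in T. -/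
/-- A rooted tree on a (finite) vertex type `V`, given by a root and a parent
function: the root is its own parent, and every vertex reaches the root by
iterating the parent function. -/
structure RTree (V : Type*) where
  root : V
  parent : V → V
  parent_root : parent root = root
  reaches_root : ∀ v : V, ∃ k : ℕ, parent^[k] v = root

namespace RTree

variable {V : Type*}

/-- `u` is a weak ancestor of `v`: `u` lies on the path from `v` to the root. -/
def weakAncestor (T : RTree V) (u v : V) : Prop :=
  ∃ k : ℕ, T.parent^[k] v = u

/-- `u` is a proper ancestor of `v`. -/
def properAncestor (T : RTree V) (u v : V) : Prop :=
  T.weakAncestor u v ∧ u ≠ v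

/-- `u` and `v` are comparable: one is a weak ancestor of the other. -/
def comparable (T : RTree V) (u v : V) : Prop :=
  T.weakAncestor u v ∨ T.weakAncestor v u

/-- The depth of a rooted tree: the maximum number of vertices on a path from
the root to a vertex. -/
noncomputable def depth [Fintype V] (T : RTree V) : ℕ :=
  Finset.univ.sup fun v => {u | T.weakAncestor u v}.ncard

end RTree

/-- `(T, J)` is a tree decomposition of the simple graph `G`: `T` is a tree,
every edge of `G` is contained in some bag, and for every vertex of `G` the
set of bags containing it induces a (nonempty) connected subtree of `T`. -/
def IsTreeDecomp {V ι : Type*} (G : SimpleGraph V) (T : SimpleGraph ι)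
    (J : ι → Finset V) : Prop :=
  T.IsTree ∧
  (∀ u v : V, G.Adj u v → ∃ t : ι, u ∈ J t ∧ v ∈ J t) ∧
  (∀ v : V, (T.induce {t : ι | v ∈ J t}).Connected)

/-- A labelling that increases along proper ancestors is monotone along weak ancestors. -/
theorem RTree.weakAncestor.label_le {V α : Type*} [Preorder α] {T : RTree V} {f : V → α}
    (hf : ∀ u v : V, T.properAncestor v u → f u < f v) {u v : V}
    (h : T.weakAncestor u v) : f v ≤ f u := by
  by_cases huv : u = v
  · rw [huv]
  · exact (hf v u ⟨h, huv⟩).le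

/-- A proper ancestor of a vertex is a weak ancestor of its parent. -/
theorem RTree.properAncestor.weakAncestor_parent {V : Type*} {T : RTree V} {u v : V}
    (h : T.properAncestor u v) : T.weakAncestor u (T.parent v) := by
  obtain ⟨⟨k, hk⟩, hne⟩ := h
  cases k with
  | zero => exact absurd hk.symm hne
  | succ k => exact ⟨k, hk⟩

theorem stmt0 {V : Type*} [Fintype V] (G : SimpleGraph V) (T : RTree V)
    (hT : ∀ (a b : V) (w : G.Walk a b), ∃ x ∈ w.support,
      T.weakAncestor x a ∧ T.weakAncestor x b)
    (π : V ≃ Fin (Fintype.card V))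
    (hπ : ∀ u v : V, T.properAncestor v u → π u < π v)
    (v u : V) (w : G.Walk v u)
    (hw : ∀ x ∈ w.support.dropLast, π x ≤ π v) :
    T.comparable u v ∧
      (π v < π u → T.properAncestor u v ∧ π (T.parent v) ≤ π u) := by
  have hcomp : T.comparable u v := by
    obtain ⟨x, hx, hxv, hxu⟩ := hT v u w
    by_cases hux : x = u
    · exact Or.inl (hux ▸ hxv)
    · have hlast : x ∈ w.support.dropLast :=
        List.mem_dropLast_of_mem_of_ne_getLast hx (by simpa using hux)
      have hle := hw x hlast
      have hxv' : x = v := π.injective (le_antisymm hle (hxv.label_le hπ))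
      exact Or.inr (hxv' ▸ hxu)
  refine ⟨hcomp, fun hlt => ?_⟩
  have hanc : T.properAncestor u v :=
    ⟨hcomp.resolve_right fun h => (h.label_le hπ).not_gt hlt, fun h => by simp [h] at hlt⟩
  exact ⟨hanc, hanc.weakAncestor_parent.label_le hπ⟩
end

section
/- Let G be a finite simple graph on vertex set {1,…,N}, let {1,…,N} be partitioned into nonempty blocks B_1,…,B_b, and let 𝒯 be a rooted tree on {1,…,b} with the property: for every sequence of blocks u = w_1,…,w_k = v such that for each i < k some element of B_{w_i} is adjacent in G to some element of B_{w_{i+1}}, there exists i with w_i a weak ancestor in 𝒯 of both u and v. Assume the indices {1,…,N} are in elimination order with respect to (B_1,…,B_b, 𝒯). Then for every symmetric positive semidefinite matrix M ∈ ℝ^{N×N} with M_{p,q} = 0 whenever p ≠ q and {p,q} ∉ E(G), there exists a lower-triangular matrix L ∈ ℝ^{N×N} with M = LLᵀ that is 𝒯-compatible. -/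
namespace Matrix

/-- A real positive semidefinite matrix with a zero diagonal entry has a zero column there. -/
lemma PosSemidef.apply_eq_zero_of_diag_eq_zero {n : Type*} [Fintype n] [DecidableEq n]
    {S : Matrix n n ℝ} (hS : S.PosSemidef) {k : n} (hk : S k k = 0) (p : n) : S p k = 0 := by
  have h := (hS.dotProduct_mulVec_zero_iff (Pi.single k 1)).1 (by simp [hk])
  simpa using congrFun h p

/-- One step of symmetric Gaussian elimination preserves positive semidefiniteness. -/
lemma PosSemidef.sub_vecMulVec_div {n : Type*} [Fintype n] [DecidableEq n]
    {S : Matrix n n ℝ} (hS : S.PosSemidef) (k : n) :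
    (of fun p q => S p q - S p k * S q k / S k k).PosSemidef := by
  have hsymm : ∀ p q, S p q = S q p := fun p q => by simpa using (hS.isHermitian.apply p q).symm
  convert hS.conjTranspose_mul_mul_same
    (1 - vecMulVec (Pi.single k 1) (fun q => S q k / S k k)) using 1
  ext p q
  by_cases hk : S k k = 0
  · have h0 : (vecMulVec (Pi.single k 1) (fun q => S q k / S k k) : Matrix n n ℝ) = 0 := by
      ext; simp [vecMulVec_apply, hk]
    rw [h0]
    simp [hk]
  · have hmul : S * (1 - vecMulVec (Pi.single k 1) (fun q => S q k / S k k)) =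
        of fun p q => S p q - S p k * S q k / S k k := by
      ext p q
      rw [mul_sub, mul_one, mul_vecMulVec]
      simp [vecMulVec_apply, mul_div_assoc]
    rw [mul_assoc, hmul, conjTranspose_sub, conjTranspose_one, sub_mul, one_mul]
    simp only [sub_apply, mul_apply, conjTranspose_apply, vecMulVec_apply, star_trivial, of_apply,
      Pi.single_apply, ite_mul, one_mul, zero_mul, Finset.sum_ite_eq', Finset.mem_univ, if_true]
    rw [hsymm k q]
    field_simp
    ring

/-- If the pattern `P` is closed under the fill-in produced by elimination, then a positive
semidefinite matrix with pattern `P`, all of whose rows before `k` vanish, has a Cholesky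
factor with pattern `P` whose columns before `k` vanish. -/
lemma PosSemidef.exists_cholesky_of_fill_closed {N : ℕ} (P : Fin N → Fin N → Prop)
    (hP : ∀ p q r, p < q → q < r → P q p → P r p → P r q) (k : ℕ) (hk : k ≤ N)
    {S : Matrix (Fin N) (Fin N) ℝ} (hS : S.PosSemidef)
    (hSP : ∀ p q, p < q → S q p ≠ 0 → P q p)
    (hS0 : ∀ p q : Fin N, (p : ℕ) < k → S p q = 0) :
    ∃ L : Matrix (Fin N) (Fin N) ℝ, (∀ p q, p < q → L p q = 0) ∧ S = L * Lᵀ ∧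
      (∀ p q, p < q → L q p ≠ 0 → P q p) ∧ ∀ p q : Fin N, (q : ℕ) < k → L p q = 0 := by
  induction hk using Nat.decreasingInduction generalizing S with
  | self =>
    refine ⟨0, by simp, ?_, by simp, by simp⟩
    ext p q
    simpa using hS0 p q p.2
  | of_succ k hkN ih =>
    have hsymm : ∀ p q, S p q = S q p :=
      fun p q => by simpa using (hS.isHermitian.apply p q).symm
    let j : Fin N := ⟨k, hkN⟩
    have hj : ∀ p : Fin N, p < j → S p j = 0 := fun p hp => hS0 p j hp
    have hcol : S j j = 0 → ∀ p, S p j = 0 := fun h => hS.apply_eq_zero_of_diag_eq_zero h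
    have hnonneg : 0 ≤ S j j := hS.diag_nonneg
    obtain ⟨L, hlow, hL, hLP, hL0⟩ := ih (hS.sub_vecMulVec_div j) (by
      intro p q hpq hne
      by_contra hn
      have h1 : S q p = 0 := by
        by_contra h
        exact hn (hSP p q hpq h)
      simp only [of_apply, h1, zero_sub, ne_eq, neg_eq_zero, div_eq_zero_iff, mul_eq_zero,
        not_or] at hne
      obtain ⟨⟨hq, hp⟩, -⟩ := hne
      have hjp : j ≤ p := not_lt.1 fun h => hp (hj p h)
      rcases hjp.eq_or_lt with rfl | hjp
      · exact hq h1
      · exact hn (hP j p q hjp hpq (hSP _ _ hjp hp) (hSP _ _ (hjp.trans hpq) hq)))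
      (by
        intro p q hp
        rcases (Nat.lt_succ_iff.1 hp).eq_or_lt with h | h
        · obtain rfl : p = j := Fin.ext h
          by_cases h0 : S j j = 0
          · simp [hsymm j q, hcol h0]
          · simp [hsymm j q, h0]
        · simp [hS0 p _ h])
    refine ⟨L.updateCol j fun p => S p j / √(S j j), ?_, ?_, ?_, ?_⟩
    · intro p q hpq
      by_cases h : q = j
      · subst h
        simp [hj p hpq]
      · simp [h, hlow p q hpq]
    · ext p q
      have hLpq := congrFun (congrFun hL p) q
      simp only [of_apply, mul_apply, transpose_apply] at hLpq
      have hsum : ∀ i, L.updateCol j (fun p => S p j / √(S j j)) p i *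
          L.updateCol j (fun p => S p j / √(S j j)) q i =
          (if i = j then S p j * S q j / S j j else 0) + L p i * L q i := by
        intro i
        by_cases h : i = j
        · subst h
          simp only [updateCol_self, if_true, hL0 p j (Nat.lt_succ_self k), zero_mul, add_zero]
          rw [div_mul_div_comm, Real.mul_self_sqrt hnonneg]
        · simp [h]
      simp only [mul_apply, transpose_apply, hsum, Finset.sum_add_distrib, Finset.sum_ite_eq',
        Finset.mem_univ, if_true, ← hLpq]
      ring
    · intro p q hpq hne
      by_cases h : p = j
      · subst h
        refine hSP _ _ hpq fun h0 => hne ?_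
        simp [h0]
      · exact hLP p q hpq (by simpa [h] using hne)
    · intro p q hq
      have h : q ≠ j := by
        rintro rfl
        exact lt_irrefl _ hq
      simpa [h] using hL0 p q (hq.trans (Nat.lt_succ_self k))

end Matrix

namespace RTree

variable {V : Type*} (T : RTree V)

lemma weakAncestor_refl (u : V) : T.weakAncestor u u := ⟨0, rfl⟩

/-- The weak ancestors of a vertex form a chain. -/
lemma comparable_of_weakAncestor {u v w : V} (hu : T.weakAncestor u w)
    (hv : T.weakAncestor v w) : T.comparable u v := by
  obtain ⟨a, rfl⟩ := hu
  obtain ⟨c, rfl⟩ := hv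
  rcases le_total a c with h | h
  · exact Or.inr ⟨c - a, by rw [← Function.iterate_add_apply, Nat.sub_add_cancel h]⟩
  · exact Or.inl ⟨a - c, by rw [← Function.iterate_add_apply, Nat.sub_add_cancel h]⟩

end RTree

theorem stmt1 {N b : ℕ} (G : SimpleGraph (Fin N))
    (B : Fin b → Finset (Fin N))
    (hBne : ∀ i : Fin b, (B i).Nonempty)
    (hBdisj : ∀ i j : Fin b, i ≠ j → Disjoint (B i) (B j))
    (hBcover : ∀ p : Fin N, ∃ i : Fin b, p ∈ B i)
    (𝒯 : RTree (Fin b))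
    (h𝒯 : ∀ (k : ℕ) (wseq : ℕ → Fin b), 0 < k →
      (∀ i : ℕ, i + 1 < k → ∃ p ∈ B (wseq i), ∃ q ∈ B (wseq (i + 1)), G.Adj p q) →
      ∃ i : ℕ, i < k ∧ 𝒯.weakAncestor (wseq i) (wseq 0) ∧
        𝒯.weakAncestor (wseq i) (wseq (k - 1)))
    (helim : ∀ i j : Fin b, 𝒯.properAncestor j i →
      ∀ p ∈ B i, ∀ q ∈ B j, p < q)
    (M : Matrix (Fin N) (Fin N) ℝ)
    (hM : M.PosSemidef)
    (hMsparse : ∀ p q : Fin N, p ≠ q → ¬ G.Adj p q → M p q = 0) :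
    ∃ L : Matrix (Fin N) (Fin N) ℝ,
      (∀ p q : Fin N, p < q → L p q = 0) ∧
      M = L * L.transpose ∧
      ∀ i j : Fin b, ¬ 𝒯.weakAncestor i j → ∀ p ∈ B i, ∀ q ∈ B j, L p q = 0 := by
  choose blk hblk using hBcover
  have hblk_eq : ∀ i p, p ∈ B i → blk p = i := fun i p hp => by
    by_contra h
    exact Finset.disjoint_left.1 (hBdisj _ _ h) (hblk p) hp
  have hanc : ∀ p q, p < q → 𝒯.comparable (blk q) (blk p) →
      𝒯.weakAncestor (blk q) (blk p) := by
    intro p q hpq hc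
    rcases hc with h | h
    · exact h
    · by_cases he : blk p = blk q
      · exact he ▸ 𝒯.weakAncestor_refl _
      · exact absurd (helim _ _ ⟨h, he⟩ q (hblk q) p (hblk p)) hpq.asymm
  obtain ⟨L, hlow, hL, hLP, -⟩ := hM.exists_cholesky_of_fill_closed
    (fun q p => 𝒯.weakAncestor (blk q) (blk p))
    (fun p q r _ hqr hq hr => hanc q r hqr (𝒯.comparable_of_weakAncestor hr hq))
    0 (Nat.zero_le N)
    (by
      intro p q hpq hne
      have hadj : G.Adj q p := by
        by_contra h
        exact hne (hMsparse q p hpq.ne' h)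
      obtain ⟨i, hi, h0, h1⟩ := h𝒯 2 (fun i => if i = 0 then blk q else blk p) (by norm_num) (by
        intro i hi
        obtain rfl : i = 0 := by omega
        exact ⟨q, by simpa using hblk q, p, by simpa using hblk p, hadj⟩)
      refine hanc p q hpq ?_
      interval_cases i
      · exact Or.inl (by simpa using h1)
      · exact Or.inr (by simpa using h0))
    (by simp)
  refine ⟨L, hlow, hL, fun i j hij p hp q hq => ?_⟩
  by_contra hne
  obtain rfl := hblk_eq i p hp
  obtain rfl := hblk_eq j q hq
  rcases lt_trichotomy p q with h | rfl | h
  · exact hne (hlow p q h)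
  · exact hij (𝒯.weakAncestor_refl _)
  · exact hij (hLP q p h hne)
end

section
/- There is an absolute constant C such that the following holds. Let G be a finite simple graph and (T,(J_t)_{t∈[k]}) a tree decomposition of G with k bags, each of size at most τ. Then there exists a rooted tree R on the vertex set V(G) of depth at most C·τ·(1 + log₂ k) such that for every path v_1,…,v_ℓ in G there exists i ∈ {1,…,ℓ} with v_i a weak ancestor in R of both v_1 and v_ℓ. -/
/-- `h` is a vertex ranking of `G` restricted to `S`: every walk inside `S` between two distinct
vertices of equal rank contains a vertex of smaller rank. -/
def IsRankingOn {V : Type*} (G : SimpleGraph V) (S : Set V) (h : V → ℕ) : Prop :=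
  ∀ u v : V, u ≠ v → h u = h v → ∀ p : G.Walk u v, (∀ x ∈ p.support, x ∈ S) →
    ∃ x ∈ p.support, h x < h u

/-- A forest order on a finite type, graded by a function `h`, is realised by a rooted tree whose
ancestor relation contains at most one further ancestor (the root) for every vertex. -/
theorem RTree.exists_of_forest_order {V : Type*} [Fintype V] [Nonempty V] (le : V → V → Prop)
    (h : V → ℕ) (refl : ∀ v, le v v) (trans : ∀ u v w, le u v → le v w → le u w)
    (chain : ∀ u u' v, le u v → le u' v → h u ≤ h u' → le u u')
    (strict : ∀ u v, le u v → u ≠ v → h u < h v) :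
    ∃ R : RTree V, (∀ u v, le u v → R.weakAncestor u v) ∧
      ∀ u v, R.weakAncestor u v → le u v ∨ u = R.root := by
  classical
  obtain ⟨r, hr⟩ := Finite.exists_min h
  have hparent : ∀ v, ∃ p, (le p v ∧ p ≠ v ∧ ∀ u, le u v → u ≠ v → h u ≤ h p) ∨
      ((∀ u, le u v → u = v) ∧ p = r) := by
    intro v
    by_cases hv : ∀ u, le u v → u = v
    · exact ⟨r, .inr ⟨hv, rfl⟩⟩
    · push Not at hv
      obtain ⟨u, hu⟩ := hv
      obtain ⟨p, hp, hmax⟩ := Finset.exists_max_image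
        (Finset.univ.filter fun u => le u v ∧ u ≠ v) h ⟨u, by simpa using hu⟩
      simp only [Finset.mem_filter, Finset.mem_univ, true_and] at hp hmax
      exact ⟨p, .inl ⟨hp.1, hp.2, fun u h1 h2 => hmax u ⟨h1, h2⟩⟩⟩
  choose par hpar using hparent
  have hrmin : ∀ u, le u r → u = r := fun u hu => by
    by_contra hne
    exact absurd (strict u r hu hne) (not_lt.2 (hr u))
  have hroot : par r = r := by
    rcases hpar r with ⟨h1, h2, -⟩ | ⟨-, h2⟩
    · exact absurd (hrmin _ h1) h2
    · exact h2
  have hreach : ∀ n v, h v = n → ∃ k : ℕ, par^[k] v = r := by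
    intro n
    induction n using Nat.strong_induction_on with
    | _ n ih =>
      intro v hv
      rcases hpar v with ⟨h1, h2, -⟩ | ⟨-, h2⟩
      · obtain ⟨k, hk⟩ := ih _ (hv ▸ strict _ _ h1 h2) (par v) rfl
        exact ⟨k + 1, by simpa using hk⟩
      · exact ⟨1, by simpa using h2⟩
  refine ⟨⟨r, par, hroot, fun v => hreach _ v rfl⟩, ?_, ?_⟩
  · have key : ∀ n u v, h v = n → le u v → ∃ k : ℕ, par^[k] v = u := by
      intro n
      induction n using Nat.strong_induction_on with
      | _ n ih =>
        intro u v hv huv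
        by_cases hne : u = v
        · exact ⟨0, by simpa using hne.symm⟩
        rcases hpar v with ⟨h1, h2, h3⟩ | ⟨h1, -⟩
        · obtain ⟨k, hk⟩ := ih _ (hv ▸ strict _ _ h1 h2) u (par v) rfl
            (chain _ _ _ huv h1 (h3 u huv hne))
          exact ⟨k + 1, by simpa using hk⟩
        · exact absurd (h1 u huv) hne
    exact fun u v huv => key _ u v rfl huv
  · rintro u v ⟨k, rfl⟩
    change le (par^[k] v) v ∨ par^[k] v = r
    induction k with
    | zero => exact .inl (refl v)
    | succ k ih =>
      rw [Function.iterate_succ_apply']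
      rcases ih with ih | ih
      · rcases hpar (par^[k] v) with ⟨h1, -, -⟩ | ⟨-, h2⟩
        · exact .inl (trans _ _ _ h1 ih)
        · exact .inr h2
      · exact .inr (by rw [ih, hroot])

/-- A vertex ranking with `D` ranks yields a rooted tree of depth at most `D + 1` in which every
walk contains a common ancestor of its ends. -/
theorem IsRankingOn.exists_rtree {V : Type*} [Fintype V] [Nonempty V] {G : SimpleGraph V}
    {h : V → ℕ} (hG : IsRankingOn G Set.univ h) {D : ℕ} (hD : ∀ v, h v < D) :
    ∃ R : RTree V, R.depth ≤ D + 1 ∧ ∀ (a b : V) (w : G.Walk a b), ∃ x ∈ w.support,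
      R.weakAncestor x a ∧ R.weakAncestor x b := by
  classical
  have strict : ∀ u v, (∃ p : G.Walk u v, ∀ x ∈ p.support, h u ≤ h x) → u ≠ v → h u < h v := by
    rintro u v ⟨p, hp⟩ hne
    refine lt_of_le_of_ne (hp v p.end_mem_support) fun heq => ?_
    obtain ⟨x, hx, hlt⟩ := hG u v hne heq p (by simp)
    exact absurd (hp x hx) (not_le.2 hlt)
  have chain : ∀ u u' v, (∃ p : G.Walk u v, ∀ x ∈ p.support, h u ≤ h x) →
      (∃ p : G.Walk u' v, ∀ x ∈ p.support, h u' ≤ h x) → h u ≤ h u' →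
      ∃ p : G.Walk u u', ∀ x ∈ p.support, h u ≤ h x := by
    rintro u u' v ⟨p, hp⟩ ⟨q, hq⟩ hle
    refine ⟨p.append q.reverse, fun x hx => ?_⟩
    rw [SimpleGraph.Walk.mem_support_append_iff, SimpleGraph.Walk.support_reverse,
      List.mem_reverse] at hx
    exact hx.elim (hp x) fun hx => hle.trans (hq x hx)
  obtain ⟨R, hle, hanc⟩ := RTree.exists_of_forest_order
    (fun u v => ∃ p : G.Walk u v, ∀ x ∈ p.support, h u ≤ h x) h
    (fun v => ⟨.nil, by simp⟩)
    (by
      rintro u v w ⟨p, hp⟩ ⟨q, hq⟩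
      refine ⟨p.append q, fun x hx => ?_⟩
      rw [SimpleGraph.Walk.mem_support_append_iff] at hx
      exact hx.elim (hp x) fun hx => (hp v p.end_mem_support).trans (hq x hx))
    chain strict
  refine ⟨R, Finset.sup_le fun v _ => ?_, fun a b w => ?_⟩
  · set A : Set V := {u | ∃ p : G.Walk u v, ∀ x ∈ p.support, h u ≤ h x}
    have hA : A.ncard ≤ D := by
      have := Set.ncard_le_ncard_of_injOn (s := A) (t := Set.Iio D) h (fun u _ => hD u) (by
        intro u hu u' hu' heq
        by_contra hne
        exact (strict u u' (chain u u' v hu hu' heq.le) hne).ne heq)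
      simpa [Set.ncard_eq_toFinset_card'] using this
    calc {u | R.weakAncestor u v}.ncard ≤ (insert R.root A).ncard :=
          Set.ncard_le_ncard (fun u hu => (hanc u v hu).symm)
      _ ≤ A.ncard + 1 := Set.ncard_insert_le _ _
      _ ≤ D + 1 := by lia
  · obtain ⟨x, hx, hmin⟩ := Finset.exists_min_image w.support.toFinset h
      ⟨a, by simp⟩
    simp only [List.mem_toFinset] at hx hmin
    refine ⟨x, hx, hle _ _ ⟨(w.takeUntil x hx).reverse, fun y hy => hmin y ?_⟩,
      hle _ _ ⟨w.dropUntil x hx, fun y hy => hmin y (w.support_dropUntil_subset_support hx hy)⟩⟩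
    rw [SimpleGraph.Walk.support_reverse, List.mem_reverse] at hy
    exact w.support_takeUntil_subset_support hx hy

namespace SimpleGraph

variable {ι : Type*} {T : SimpleGraph ι}

/-- If `c'` is closer to `x` than its neighbour `c`, then `x` is joined to `c'` by a walk
avoiding `c`. -/
theorem Connected.exists_walk_notMem_support (hT : T.Connected) {c c' x : ι}
    (hlt : T.dist c' x < T.dist c x) : ∃ p : T.Walk c' x, c ∉ p.support := by
  classical
  obtain ⟨p, hp⟩ := hT.exists_walk_length_eq_dist c' x
  refine ⟨p, fun hc => ?_⟩
  have h1 := dist_le (p.dropUntil c hc)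
  have h2 := p.length_dropUntil_le_length hc
  lia

/-- In an acyclic graph, the ends of an edge are not joined by a walk avoiding that edge. -/
theorem IsAcyclic.mem_edges_of_adj (hT : T.IsAcyclic) {c c' : ι} (hadj : T.Adj c c')
    (p : T.Walk c c') : s(c, c') ∈ p.edges :=
  isBridge_iff_forall_walk_mem_edges.1 (isAcyclic_iff_forall_adj_isBridge.1 hT hadj) p

theorem IsTree.eq_of_dist_lt (hT : T.IsTree) {c a b x : ι} (ha : T.Adj c a) (hb : T.Adj c b)
    (hax : T.dist a x < T.dist c x) (hbx : T.dist b x < T.dist c x) : a = b := by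
  by_contra hne
  obtain ⟨p, hp⟩ := hT.1.exists_walk_notMem_support hax
  obtain ⟨q, hq⟩ := hT.1.exists_walk_notMem_support hbx
  have := hT.2.mem_edges_of_adj ha (.cons hb (q.append p.reverse))
  rw [Walk.edges_cons, List.mem_cons, Walk.edges_append, List.mem_append, Walk.edges_reverse,
    List.mem_reverse] at this
  rcases this with h | h | h
  · rw [Sym2.congr_right] at h
    exact hne h
  · exact hq (q.fst_mem_support_of_mem_edges h)
  · exact hp (p.fst_mem_support_of_mem_edges h)

/-- Adjacent vertices different from `c` lie in the same branch at `c`. -/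
theorem IsTree.dist_lt_of_adj (hT : T.IsTree) {c a x y : ι} (ha : T.Adj c a) (hxy : T.Adj x y)
    (hx : x ≠ c) (hy : y ≠ c) (hax : T.dist a x < T.dist c x) : T.dist a y < T.dist c y := by
  by_contra hle
  have hlt : T.dist c y < T.dist a y :=
    lt_of_le_of_ne (not_lt.1 hle) (by
      rw [T.dist_comm (u := c), T.dist_comm (u := a)]
      exact hT.dist_ne_of_adj y ha)
  obtain ⟨p, hp⟩ := hT.1.exists_walk_notMem_support hax
  obtain ⟨q, hq⟩ := hT.1.exists_walk_notMem_support hlt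
  have := hT.2.mem_edges_of_adj ha (q.append (.cons hxy.symm p.reverse))
  rw [Walk.edges_append, List.mem_append, Walk.edges_cons, List.mem_cons, Walk.edges_reverse,
    List.mem_reverse] at this
  rcases this with h | h | h
  · exact hq (q.snd_mem_support_of_mem_edges h)
  · rcases Sym2.eq_iff.1 h with ⟨h1, -⟩ | ⟨h1, -⟩
    · exact hy h1.symm
    · exact hx h1.symm
  · exact hp (p.fst_mem_support_of_mem_edges h)

/-- Every finite tree has a vertex each of whose branches contains at most half of `S`. -/
theorem exists_centroid [Finite ι] [Nonempty ι] (T : SimpleGraph ι) (S : Finset ι) :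
    ∃ c, ∀ a, T.Adj c a → 2 * (S.filter fun x => T.dist a x < T.dist c x).card ≤ S.card := by
  obtain ⟨c, hc⟩ := Finite.exists_min fun c => ∑ x ∈ S, T.dist c x
  refine ⟨c, fun a ha => ?_⟩
  have hle : ∑ x ∈ S, (T.dist a x + 2 * if T.dist a x < T.dist c x then 1 else 0) ≤
      ∑ x ∈ S, (T.dist c x + 1) := by
    refine Finset.sum_le_sum fun x _ => ?_
    split_ifs with h
    · lia
    · have := ha.symm.reachable.dist_triangle_left x
      rw [dist_eq_one_iff_adj.2 ha.symm] at this
      lia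
  rw [Finset.sum_add_distrib, Finset.sum_add_distrib, ← Finset.mul_sum, ← Finset.card_filter,
    Finset.sum_const, smul_eq_mul, mul_one] at hle
  have := hc a
  lia

/-- A set of fewer than `2 ^ d` vertices of a finite tree has a vertex ranking with `d` ranks. -/
theorem IsTree.exists_isRankingOn [Finite ι] (hT : T.IsTree) (d : ℕ) :
    ∀ S : Finset ι, S.card < 2 ^ d → ∃ g : ι → ℕ, (∀ x ∈ S, g x < d) ∧ IsRankingOn T S g := by
  classical
  have := hT.1.nonempty
  induction d with
  | zero =>
    intro S hS
    obtain rfl : S = ∅ := by simpa using hS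
    exact ⟨0, by simp, fun u v _ _ p hp => absurd (hp u p.start_mem_support) (by simp)⟩
  | succ d ih =>
    intro S hS
    obtain ⟨c, hc⟩ := T.exists_centroid S
    have hbranch : ∀ x, ∃ a, x ≠ c → T.Adj c a ∧ T.dist a x < T.dist c x := by
      intro x
      by_cases hx : x = c
      · exact ⟨c, fun h => absurd hx h⟩
      obtain ⟨p, hp⟩ := hT.1.exists_walk_length_eq_dist c x
      cases p with
      | nil => exact absurd rfl hx
      | @cons _ a _ hca q =>
        refine ⟨a, fun _ => ⟨hca, ?_⟩⟩
        have := dist_le q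
        rw [Walk.length_cons] at hp
        lia
    choose f hf using hbranch
    have hfadj : ∀ x y, T.Adj x y → x ≠ c → y ≠ c → f x = f y := fun x y hxy hx hy =>
      hT.eq_of_dist_lt (hf x hx).1 (hf y hy).1 (hf x hx).2
        (hT.dist_lt_of_adj (hf y hy).1 hxy.symm hy hx (hf y hy).2)
    have hfwalk : ∀ {u v : ι} (p : T.Walk u v), c ∉ p.support → ∀ x ∈ p.support, f x = f u := by
      intro u v p
      induction p with
      | nil => simp
      | @cons u w v h p ihp =>
        intro hcp x hx
        rw [Walk.support_cons, List.mem_cons, not_or] at hcp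
        rw [Walk.support_cons, List.mem_cons] at hx
        rcases hx with rfl | hx
        · rfl
        · rw [ihp hcp.2 x hx]
          exact (hfadj _ _ h (Ne.symm hcp.1) fun h => hcp.2 (h ▸ p.start_mem_support)).symm
    have hsub : ∀ a, ∃ g : ι → ℕ, (∀ x ∈ S.filter fun x => x ≠ c ∧ f x = a, g x < d) ∧
        IsRankingOn T (S.filter fun x => x ≠ c ∧ f x = a) g := by
      intro a
      refine ih _ ?_
      by_cases ha : T.Adj c a
      · have hcard : (S.filter fun x => x ≠ c ∧ f x = a).card ≤
            (S.filter fun x => T.dist a x < T.dist c x).card :=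
          Finset.card_le_card (Finset.monotone_filter_right S
            fun x _ (hx : x ≠ c ∧ f x = a) => hx.2 ▸ (hf x hx.1).2)
        have := hc a ha
        rw [pow_succ] at hS
        lia
      · rw [Finset.filter_false_of_mem fun x _ (hx : x ≠ c ∧ f x = a) =>
          ha (hx.2 ▸ (hf x hx.1).1)]
        simp
    choose g hgd hg using hsub
    refine ⟨fun x => if x = c then 0 else g (f x) x + 1, fun x hx => ?_, fun u v hne huv p hp => ?_⟩
    · dsimp only
      split_ifs with hxc
      · lia
      · have := hgd (f x) x (by simp [hx, hxc])
        lia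
    · dsimp only at huv ⊢
      by_cases huc : u = c
      · subst huc
        simp [Ne.symm hne] at huv
      by_cases hcp : c ∈ p.support
      · exact ⟨c, hcp, by simp [huc]⟩
      have hpc : ∀ x ∈ p.support, x ≠ c := fun x hx h => hcp (h ▸ hx)
      have hpf := hfwalk p hcp
      have hvc := hpc v p.end_mem_support
      rw [if_neg huc, if_neg hvc, hpf v p.end_mem_support, Nat.add_right_cancel_iff] at huv
      obtain ⟨x, hx, hlt⟩ := hg (f u) u v hne huv p fun x hx => by
        have hxS := hp x hx
        simp only [Finset.coe_filter, Set.mem_ofPred_eq]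
        exact ⟨hxS, hpc x hx, hpf x hx⟩
      refine ⟨x, hx, ?_⟩
      rw [if_neg huc, if_neg (hpc x hx), hpf x hx]
      lia

end SimpleGraph

namespace IsTreeDecomp

variable {V ι : Type*} {G : SimpleGraph V} {T : SimpleGraph ι} {J : ι → Finset V}

theorem exists_walk_of_mem (hJ : IsTreeDecomp G T J) {v : V} {s t : ι} (hs : v ∈ J s)
    (ht : v ∈ J t) : ∃ p : T.Walk s t, ∀ r ∈ p.support, v ∈ J r := by
  obtain ⟨p⟩ := (hJ.2.2 v).preconnected ⟨s, hs⟩ ⟨t, ht⟩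
  let φ : T.induce {t | v ∈ J t} →g T := (SimpleGraph.Embedding.induce _).toHom
  refine ⟨p.map φ, fun r hr => ?_⟩
  obtain ⟨x, -, rfl⟩ := List.mem_map.1 (p.support_map φ ▸ hr)
  exact x.2

/-- A walk of `G` lifts to a walk of the decomposition tree through bags meeting it. -/
theorem exists_lift_walk (hJ : IsTreeDecomp G T J) {u v : V} (w : G.Walk u v) {t : ι}
    (ht : v ∈ J t) : ∀ {s : ι}, u ∈ J s →
      ∃ p : T.Walk s t, ∀ r ∈ p.support, ∃ x ∈ w.support, x ∈ J r := by
  induction w with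
  | nil =>
    intro s hs
    obtain ⟨p, hp⟩ := hJ.exists_walk_of_mem hs ht
    exact ⟨p, fun r hr => ⟨_, by simp, hp r hr⟩⟩
  | @cons u a v h w ih =>
    intro s hs
    obtain ⟨b, hub, hab⟩ := hJ.2.1 u a h
    obtain ⟨p, hp⟩ := hJ.exists_walk_of_mem hs hub
    obtain ⟨q, hq⟩ := ih ht hab
    refine ⟨p.append q, fun r hr => ?_⟩
    rw [SimpleGraph.Walk.mem_support_append_iff] at hr
    rcases hr with hr | hr
    · exact ⟨u, by simp, hp r hr⟩
    · obtain ⟨x, hx, hxr⟩ := hq r hr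
      exact ⟨x, by simp [hx], hxr⟩

/-- A ranking of the decomposition tree with `d` ranks induces a ranking of the graph with
`τ * d` ranks, where `τ` bounds the sizes of the bags. -/
theorem exists_isRankingOn [Finite ι] (hJ : IsTreeDecomp G T J) {τ d : ℕ}
    (hτ : ∀ t, (J t).card ≤ τ) {g : ι → ℕ} (hgd : ∀ t, g t < d)
    (hg : IsRankingOn T Set.univ g) :
    ∃ h : V → ℕ, (∀ v, h v < τ * d) ∧ IsRankingOn G Set.univ h := by
  have htop : ∀ v, ∃ t, v ∈ J t ∧ ∀ s, v ∈ J s → g t ≤ g s := by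
    intro v
    obtain ⟨t₀, ht₀⟩ := (hJ.2.2 v).nonempty
    obtain ⟨t, ht, hmin⟩ := Set.exists_min_image {t | v ∈ J t} g (Set.toFinite _) ⟨t₀, ht₀⟩
    exact ⟨t, ht, hmin⟩
  choose top hmem hmin using htop
  let idx : V → ℕ := fun v => (J (top v)).equivFin ⟨v, hmem v⟩
  have hidx : ∀ v, idx v < τ := fun v => (Fin.is_lt _).trans_le (hτ _)
  have hidx_inj : ∀ u v, top u = top v → idx u = idx v → u = v := by
    have : ∀ (s t : ι) (u v : V) (hu : u ∈ J s) (hv : v ∈ J t), s = t →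
        ((J s).equivFin ⟨u, hu⟩ : ℕ) = (J t).equivFin ⟨v, hv⟩ → u = v := by
      rintro s _ u v hu hv rfl h
      simpa using (J s).equivFin.injective (Fin.ext h)
    exact fun u v h1 h2 => this _ _ u v _ _ h1 h2
  refine ⟨fun v => τ * g (top v) + idx v, fun v => ?_, fun u v hne huv w _ => ?_⟩
  · calc τ * g (top v) + idx v < τ * (g (top v) + 1) := by
          rw [mul_add_one]
          exact Nat.add_lt_add_left (hidx v) _
      _ ≤ τ * d := Nat.mul_le_mul_left _ (hgd _)
  · dsimp only at huv ⊢
    have hpos : 0 < τ := (Nat.zero_le _).trans_lt (hidx u)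
    have hgeq : g (top u) = g (top v) := by
      have := congrArg (· / τ) huv
      simpa [Nat.mul_add_div hpos, Nat.div_eq_of_lt (hidx _)] using this
    have htop_ne : top u ≠ top v := fun h =>
      hne (hidx_inj u v h (by rw [hgeq] at huv; exact Nat.add_left_cancel huv))
    obtain ⟨p, hp⟩ := hJ.exists_lift_walk w (hmem v) (hmem u)
    obtain ⟨t, ht, hlt⟩ := hg _ _ htop_ne hgeq p (by simp)
    obtain ⟨x, hx, hxt⟩ := hp t ht
    refine ⟨x, hx, ?_⟩
    have hxu : g (top x) + 1 ≤ g (top u) := (hmin x t hxt).trans_lt hlt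
    calc τ * g (top x) + idx x < τ * (g (top x) + 1) := by
          rw [mul_add_one]
          exact Nat.add_lt_add_left (hidx x) _
      _ ≤ τ * g (top u) := Nat.mul_le_mul_left _ hxu
      _ ≤ τ * g (top u) + idx u := Nat.le_add_right _ _

end IsTreeDecomp

theorem stmt4 :
    ∃ C : ℕ, ∀ (V : Type) [Fintype V] [Nonempty V] (G : SimpleGraph V)
      (k τ : ℕ) (T : SimpleGraph (Fin k)) (J : Fin k → Finset V),
      IsTreeDecomp G T J → (∀ t : Fin k, (J t).card ≤ τ) →
      ∃ R : RTree V,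
        R.depth ≤ C * τ * (1 + Nat.log 2 k) ∧
        ∀ (a b : V) (w : G.Walk a b), ∃ x ∈ w.support,
          R.weakAncestor x a ∧ R.weakAncestor x b := by
  refine ⟨2, fun V _ _ G k τ T J hJ hτ => ?_⟩
  obtain ⟨g, hgd, hg⟩ := hJ.1.exists_isRankingOn (1 + Nat.log 2 k) Finset.univ (by
    rw [Finset.card_fin, add_comm]
    exact Nat.lt_pow_succ_log_self one_lt_two k)
  obtain ⟨h, hhd, hh⟩ := hJ.exists_isRankingOn hτ (fun t => hgd t (Finset.mem_univ t))
    (by simpa using hg)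
  obtain ⟨R, hR, hwalk⟩ := hh.exists_rtree hhd
  refine ⟨R, hR.trans ?_, hwalk⟩
  have := hhd (Classical.arbitrary V)
  rw [mul_assoc]
  lia
end

section
/- There is an absolute constant C such that the following holds. Let G be a finite simple graph and (T,(J_t)_{t∈[k]}) a tree decomposition of G with k bags, each of size at most τ. Then there exist a partition of V(G) into at most k nonempty blocks, each block contained in some bag J_t (so each block has size at most τ), and a rooted tree 𝒯 on these blocks of depth at most C·(1 + log₂ k), such that for every path v_1,…,v_ℓ in G there exists i ∈ {1,…,ℓ} for which the block containing v_i is a weak ancestor in 𝒯 of both the block containing v_1 and the block containing v_ℓ. -/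
namespace RTree

variable {B : Type*}

/-- A finite order-theoretic forest, graded by a level function, extends to the ancestor
relation of a rooted tree whose depth exceeds the maximal level by at most two. -/
theorem exists_of_forest [Fintype B] [Nonempty B] (anc : B → B → Prop) (lev : B → ℕ) (d : ℕ)
    (chain : ∀ u v w, anc u v → anc w v → anc u w ∨ anc w u)
    (lev_lt : ∀ u v, anc u v → u ≠ v → lev u < lev v)
    (lev_le : ∀ v, lev v ≤ d) :
    ∃ R : RTree B, (∀ u v, anc u v → R.weakAncestor u v) ∧ R.depth ≤ d + 2 := by
  classical
  obtain ⟨r, hr⟩ := Finite.exists_min lev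
  have exists_parent : ∀ v, ∃ p, (v = r → p = r) ∧
      ((∃ u, anc u v ∧ u ≠ v) → anc p v ∧ p ≠ v ∧ ∀ u, anc u v → u ≠ v → lev u ≤ lev p) ∧
      ((¬ ∃ u, anc u v ∧ u ≠ v) → p = r) := by
    intro v
    by_cases h : ∃ u, anc u v ∧ u ≠ v
    · obtain ⟨p, hp, hmax⟩ := Set.exists_max_image {u | anc u v ∧ u ≠ v} lev
        (Set.toFinite _) h
      refine ⟨p, ?_, fun _ => ⟨hp.1, hp.2, fun u hu hne => hmax u ⟨hu, hne⟩⟩, fun hn => (hn h).elim⟩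
      rintro rfl
      exact absurd (lev_lt _ _ hp.1 hp.2) (hr p).not_gt
    · exact ⟨r, fun _ => rfl, fun hh => (h hh).elim, fun _ => rfl⟩
  choose par par_root par_max par_min using exists_parent
  have iterate_root : ∀ j, par^[j] r = r := fun j => Function.iterate_fixed (par_root r rfl) j
  have reaches : ∀ n v, lev v < n → ∃ j, par^[j] v = r := by
    intro n
    induction n with
    | zero => intro v hv; omega
    | succ n ih =>
      intro v hv
      by_cases h : ∃ u, anc u v ∧ u ≠ v
      · obtain ⟨h1, h2, -⟩ := par_max v h
        have := lev_lt _ _ h1 h2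
        obtain ⟨j, hj⟩ := ih (par v) (by omega)
        exact ⟨j + 1, by simpa using hj⟩
      · exact ⟨1, by simpa using par_min v h⟩
  refine ⟨⟨r, par, par_root r rfl, fun v => reaches _ v (Nat.lt_succ_self _)⟩, ?_, ?_⟩
  · have key : ∀ n u v, lev v < n → anc u v → ∃ j, par^[j] v = u := by
      intro n
      induction n with
      | zero => intro u v hv; omega
      | succ n ih =>
        intro u v hv huv
        by_cases hne : u = v
        · exact ⟨0, by simp [hne]⟩
        · obtain ⟨h1, h2, h3⟩ := par_max v ⟨u, huv, hne⟩
          have hlt := lev_lt _ _ h1 h2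
          by_cases hup : u = par v
          · exact ⟨1, by simp [hup]⟩
          · have hanc : anc u (par v) := by
              rcases chain _ _ _ huv h1 with h | h
              · exact h
              · exact absurd (lev_lt _ _ h (Ne.symm hup)) (h3 u huv hne).not_gt
            obtain ⟨j, hj⟩ := ih u (par v) (by omega) hanc
            exact ⟨j + 1, by simpa using hj⟩
    exact fun u v h => key _ u v (Nat.lt_succ_self _) h
  · have key : ∀ n v, lev v < n → {u | ∃ j, par^[j] v = u}.ncard ≤ lev v + 2 := by
      intro n
      induction n with
      | zero => intro v hv; omega
      | succ n ih =>
        intro v hv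
        have hsub : {u | ∃ j, par^[j] v = u} ⊆ insert v {u | ∃ j, par^[j] (par v) = u} := by
          rintro u ⟨j, rfl⟩
          cases j with
          | zero => exact Or.inl rfl
          | succ j => exact Or.inr ⟨j, rfl⟩
        have hcard := (Set.ncard_le_ncard hsub (Set.toFinite _)).trans (Set.ncard_insert_le _ _)
        by_cases h : ∃ u, anc u v ∧ u ≠ v
        · obtain ⟨h1, h2, -⟩ := par_max v h
          have := lev_lt _ _ h1 h2
          have := ih (par v) (by omega)
          omega
        · have : {u | ∃ j, par^[j] (par v) = u} = {r} := by
            ext u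
            simp [par_min v h, iterate_root, eq_comm]
          rw [this, Set.ncard_singleton] at hcard
          omega
    refine Finset.sup_le fun v _ => ?_
    exact (key _ v (Nat.lt_succ_self _)).trans (Nat.add_le_add_right (lev_le v) 2)

end RTree

namespace SimpleGraph

variable {V ι : Type*}

/-- Any two vertices of `P` are joined by a walk inside `P`. -/
def WalkConnected (T : SimpleGraph ι) (P : Set ι) : Prop :=
  ∀ x ∈ P, ∀ y ∈ P, ∃ w : T.Walk x y, ∀ z ∈ w.support, z ∈ P

variable {T : SimpleGraph ι}

theorem Preconnected.walkConnected {P : Set ι} (h : (T.induce P).Preconnected) :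
    T.WalkConnected P := by
  intro x hx y hy
  obtain ⟨w⟩ := h ⟨x, hx⟩ ⟨y, hy⟩
  refine ⟨w.map (Embedding.induce P).toHom, fun z hz => ?_⟩
  obtain ⟨z', -, rfl⟩ := List.mem_map.1 (Walk.support_map (Embedding.induce P).toHom w ▸ hz)
  exact z'.2

theorem WalkConnected.union {P Q : Set ι} (hP : T.WalkConnected P) (hQ : T.WalkConnected Q)
    {v : ι} (hvP : v ∈ P) (hvQ : v ∈ Q) : T.WalkConnected (P ∪ Q) := by
  have to_v : ∀ x ∈ P ∪ Q, ∃ w : T.Walk x v, ∀ z ∈ w.support, z ∈ P ∪ Q := by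
    rintro x (hx | hx)
    · obtain ⟨w, hw⟩ := hP x hx v hvP
      exact ⟨w, fun z hz => Or.inl (hw z hz)⟩
    · obtain ⟨w, hw⟩ := hQ x hx v hvQ
      exact ⟨w, fun z hz => Or.inr (hw z hz)⟩
  intro x hx y hy
  obtain ⟨w, hw⟩ := to_v x hx
  obtain ⟨w', hw'⟩ := to_v y hy
  refine ⟨w.append w'.reverse, fun z hz => ?_⟩
  rw [Walk.mem_support_append_iff, Walk.support_reverse, List.mem_reverse] at hz
  exact hz.elim (hw z) (hw' z)

/-- A walk-connected set avoiding `c` lies on the side of a single neighbour of `c`. -/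
theorem WalkConnected.exists_adj (hT : T.Connected) {P : Set ι} (hP : T.WalkConnected P)
    (hne : P.Nonempty) {c : ι} (hc : c ∉ P) :
    ∃ d, T.Adj c d ∧ ∀ x ∈ P, ∃ w : T.Walk d x, c ∉ w.support := by
  obtain ⟨y, hy⟩ := hne
  obtain ⟨p, hp⟩ := hT.exists_isPath c y
  cases p with
  | nil => exact (hc hy).elim
  | cons h q =>
    rw [Walk.cons_isPath_iff] at hp
    refine ⟨_, h, fun x hx => ?_⟩
    obtain ⟨w, hw⟩ := hP y hy x hx
    refine ⟨q.append w, fun hmem => ?_⟩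
    rw [Walk.mem_support_append_iff] at hmem
    exact hmem.elim hp.2 fun h => hc (hw c h)

/-- Every finite tree has a centroid with respect to any set `S` of vertices. -/
theorem IsTree.exists_centroid [Finite ι] (hT : T.IsTree) (S : Set ι) :
    ∃ c, ∀ P : Set ι, P ⊆ S → T.WalkConnected P → c ∉ P → 2 * P.ncard ≤ S.ncard := by
  classical
  have := Fintype.ofFinite ι
  by_contra! hcon
  choose P hPS hPconn hPc hPbig using hcon
  have hne : ∀ c, (P c).Nonempty := fun c => by
    rw [← Set.ncard_pos]
    have := hPbig c
    omega
  choose f hadj hside using fun c => (hPconn c).exists_adj hT.connected (hne c) (hPc c)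
  obtain ⟨c, d, hcd, heq⟩ : ∃ c d, c ≠ d ∧ s(c, f c) = s(d, f d) := by
    have hlt : T.edgeFinset.card < (Finset.univ : Finset ι).card := by
      rw [Finset.card_univ, ← hT.card_edgeFinset]
      exact Nat.lt_succ_self _
    obtain ⟨c, -, d, -, hcd, heq⟩ := Finset.exists_ne_map_eq_of_card_lt_of_maps_to hlt
      (f := fun c => s(c, f c)) (fun c _ => by simpa using hadj c)
    exact ⟨c, d, hcd, heq⟩
  obtain ⟨hcfd, hfcd⟩ : c = f d ∧ f c = d := by
    rcases Sym2.eq_iff.1 heq with h | h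
    · exact (hcd h.1).elim
    · exact h
  obtain ⟨x, hxc, hxd⟩ : (P c ∩ P d).Nonempty := by
    by_contra hempty
    have hdisj := Set.disjoint_iff_inter_eq_empty.2 (Set.not_nonempty_iff_eq_empty.1 hempty)
    have h1 := Set.ncard_union_eq hdisj
    have h2 := Set.ncard_le_ncard (Set.union_subset (hPS c) (hPS d))
    have := hPbig c
    have := hPbig d
    omega
  obtain ⟨w, hw⟩ := hside d x hxd
  obtain ⟨w', hw'⟩ := hside c x hxc
  have hbridge := isAcyclic_iff_forall_adj_isBridge.1 hT.isAcyclic (hadj c)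
  rw [isBridge_iff_forall_walk_mem_edges] at hbridge
  have hmem := hbridge ((w.append w'.reverse).copy hcfd.symm rfl)
  rw [Walk.edges_copy, Walk.edges_append, Walk.edges_reverse, List.mem_append,
    List.mem_reverse] at hmem
  rcases hmem with h | h
  · exact hw (hfcd ▸ w.snd_mem_support_of_mem_edges h)
  · exact hw' (w'.fst_mem_support_of_mem_edges h)

/-- A tree has a vertex ranking with logarithmically many levels: every walk-connected set has at
most one vertex of minimal level. -/
theorem IsTree.exists_ranking [Finite ι] (hT : T.IsTree) (n : ℕ) (S : Set ι)
    (hS : S.ncard < 2 ^ n) :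
    ∃ lev : ι → ℕ, (∀ x ∈ S, lev x < n) ∧ ∀ P ⊆ S, T.WalkConnected P → ∀ u ∈ P, ∀ v ∈ P,
      (∀ x ∈ P, lev u ≤ lev x) → (∀ x ∈ P, lev v ≤ lev x) → u = v := by
  classical
  induction n generalizing S with
  | zero =>
    have : S = ∅ := by rw [← Set.ncard_eq_zero]; simpa using hS
    subst this
    exact ⟨fun _ => 0, by simp, fun P hP _ u hu => (hP hu).elim⟩
  | succ n ih =>
    obtain ⟨c, hc⟩ := hT.exists_centroid S
    let K : ι → Set ι := fun x => {y | ∃ w : T.Walk x y, ∀ z ∈ w.support, z ∈ S ∧ z ≠ c}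
    have K_sub : ∀ x, K x ⊆ {z | z ∈ S ∧ z ≠ c} := fun x y ⟨w, hw⟩ => hw y w.end_mem_support
    have K_conn : ∀ x, T.WalkConnected (K x) := by
      rintro x y ⟨w, hw⟩ z ⟨w', hw'⟩
      have hwalk : ∀ t ∈ (w.reverse.append w').support, t ∈ S ∧ t ≠ c := by
        intro t ht
        rw [Walk.mem_support_append_iff, Walk.support_reverse, List.mem_reverse] at ht
        exact ht.elim (hw t) (hw' t)
      refine ⟨w.reverse.append w', fun t ht => ⟨w.append ((w.reverse.append w').takeUntil t ht),
        fun s hs => ?_⟩⟩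
      rw [Walk.mem_support_append_iff] at hs
      exact hs.elim (hw s) fun h => hwalk s (Walk.support_takeUntil_subset_support _ ht h)
    have K_eq : ∀ x y, y ∈ K x → K x = K y := by
      rintro x y ⟨w, hw⟩
      ext z
      constructor
      · rintro ⟨w', hw'⟩
        refine ⟨w.reverse.append w', fun t ht => ?_⟩
        rw [Walk.mem_support_append_iff, Walk.support_reverse, List.mem_reverse] at ht
        exact ht.elim (hw t) (hw' t)
      · rintro ⟨w', hw'⟩
        refine ⟨w.append w', fun t ht => ?_⟩
        rw [Walk.mem_support_append_iff] at ht
        exact ht.elim (hw t) (hw' t)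
    have K_card : ∀ x, (K x).ncard < 2 ^ n := fun x => by
      have := hc (K x) (fun y hy => (K_sub x hy).1) (K_conn x) (fun h => (K_sub x h).2 rfl)
      rw [pow_succ] at hS
      omega
    have rank : ∀ Q : Set ι, Q.ncard < 2 ^ n → ∃ lev : ι → ℕ, (∀ x ∈ Q, lev x < n) ∧
        ∀ P ⊆ Q, T.WalkConnected P → ∀ u ∈ P, ∀ v ∈ P,
          (∀ x ∈ P, lev u ≤ lev x) → (∀ x ∈ P, lev v ≤ lev x) → u = v := fun Q hQ => ih Q hQ
    choose! L L_lt L_uniq using rank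
    refine ⟨fun x => if x = c then 0 else L (K x) x + 1, ?_, ?_⟩
    · intro x hx
      by_cases h : x = c
      · simp [h]
      · have : x ∈ K x := ⟨Walk.nil, by simpa using ⟨hx, h⟩⟩
        simpa [h] using L_lt _ (K_card x) x this
    · intro P hPS hP u hu v hv hminu hminv
      by_cases hcP : c ∈ P
      · have eq_c : ∀ y, (∀ x ∈ P, (if y = c then 0 else L (K y) y + 1) ≤
            if x = c then 0 else L (K x) x + 1) → y = c := by
          intro y hy
          by_contra hne
          simpa [hne] using hy c hcP
        rw [eq_c u hminu, eq_c v hminv]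
      · have hPK : ∀ x ∈ P, x ∈ K u := by
          intro x hx
          obtain ⟨w, hw⟩ := hP u hu x hx
          exact ⟨w, fun z hz => ⟨hPS (hw z hz), fun (h : z = c) => hcP (h ▸ hw z hz)⟩⟩
        have lev_eq : ∀ x ∈ P, (if x = c then 0 else L (K x) x + 1) = L (K u) x + 1 := by
          intro x hx
          rw [if_neg (fun h : x = c => hcP (h ▸ hx)), K_eq u x (hPK x hx)]
        refine L_uniq (K u) (K_card u) P hPK hP u hu v hv (fun x hx => ?_) fun x hx => ?_
        · have := hminu x hx
          simp only [lev_eq x hx, lev_eq u hu] at this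
          omega
        · have := hminv x hx
          simp only [lev_eq x hx, lev_eq v hv] at this
          omega

/-- The centroid forest of a tree: an order-theoretic forest on the vertices of logarithmic height
in which every nonempty walk-connected set has a top element. -/
theorem IsTree.exists_centroid_forest [Finite ι] (hT : T.IsTree) :
    ∃ (anc : ι → ι → Prop) (lev : ι → ℕ),
      (∀ u v w, anc u v → anc w v → anc u w ∨ anc w u) ∧
      (∀ u v, anc u v → u ≠ v → lev u < lev v) ∧
      (∀ v, lev v ≤ Nat.log 2 (Nat.card ι)) ∧
      ∀ P : Set ι, T.WalkConnected P → P.Nonempty → ∃ t ∈ P, ∀ s ∈ P, anc t s := by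
  obtain ⟨lev, lev_lt, uniq⟩ := hT.exists_ranking (Nat.log 2 (Nat.card ι) + 1) Set.univ
    (by rw [Set.ncard_univ]; exact Nat.lt_pow_succ_log_self (by norm_num) _)
  refine ⟨fun u v => ∃ P, T.WalkConnected P ∧ u ∈ P ∧ v ∈ P ∧ ∀ x ∈ P, lev u ≤ lev x, lev,
    ?_, ?_, fun v => Nat.lt_succ_iff.1 (lev_lt v trivial), ?_⟩
  · rintro u v w ⟨P, hP, huP, hvP, hu⟩ ⟨Q, hQ, hwQ, hvQ, hw⟩
    have hPQ := hP.union hQ hvP hvQ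
    rcases le_total (lev u) (lev w) with h | h
    · exact Or.inl ⟨_, hPQ, Or.inl huP, Or.inr hwQ,
        fun x hx => hx.elim (hu x) fun hx => h.trans (hw x hx)⟩
    · exact Or.inr ⟨_, hPQ, Or.inr hwQ, Or.inl huP,
        fun x hx => hx.elim (fun hx => h.trans (hu x hx)) (hw x)⟩
  · rintro u v ⟨P, hP, huP, hvP, hu⟩ hne
    refine lt_of_le_of_ne (hu v hvP) fun h => hne ?_
    exact uniq P (Set.subset_univ _) hP u huP v hvP hu (h ▸ hu)
  · intro P hP hne
    obtain ⟨t, ht, hmin⟩ := Set.exists_min_image P lev (Set.toFinite _) hne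
    exact ⟨t, ht, fun s hs => ⟨P, hP, ht, hs, hmin⟩⟩

end SimpleGraph

/-- The bags of a tree decomposition meeting the support of a walk form a connected set. -/
theorem IsTreeDecomp.walkConnected_support {V ι : Type*} {G : SimpleGraph V} {T : SimpleGraph ι}
    {J : ι → Finset V} (h : IsTreeDecomp G T J) {a c : V} (w : G.Walk a c) :
    T.WalkConnected {t | ∃ x ∈ w.support, x ∈ J t} := by
  induction w with
  | nil => simpa using (h.2.2 _).preconnected.walkConnected
  | @cons u v _ hadj p ih =>
    obtain ⟨t, hut, hvt⟩ := h.2.1 _ _ hadj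
    have := (h.2.2 u).preconnected.walkConnected.union ih (v := t) hut
      ⟨v, p.start_mem_support, hvt⟩
    convert this using 1
    ext s
    simp

theorem stmt5 :
    ∃ C : ℕ, ∀ (V : Type) [Fintype V] [Nonempty V] (G : SimpleGraph V)
      (k τ : ℕ) (T : SimpleGraph (Fin k)) (J : Fin k → Finset V),
      IsTreeDecomp G T J → (∀ t : Fin k, (J t).card ≤ τ) →
      ∃ (b : ℕ) (blk : V → Fin b) (𝒯 : RTree (Fin b)),
        b ≤ k ∧
        Function.Surjective blk ∧
        (∀ i : Fin b, ∃ t : Fin k, ∀ v : V, blk v = i → v ∈ J t) ∧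
        𝒯.depth ≤ C * (1 + Nat.log 2 k) ∧
        ∀ (a c : V) (w : G.Walk a c), ∃ x ∈ w.support,
          𝒯.weakAncestor (blk x) (blk a) ∧ 𝒯.weakAncestor (blk x) (blk c) := by
  classical
  refine ⟨2, fun V _ _ G k τ T J hJ _ => ?_⟩
  obtain ⟨anc, lev, chain, lev_lt, lev_le, exists_top⟩ := hJ.1.exists_centroid_forest
  rw [Nat.card_fin] at lev_le
  have bags : ∀ v, ∃ t, v ∈ J t ∧ ∀ s, v ∈ J s → anc t s := fun v => by
    have hne : {t | v ∈ J t}.Nonempty := Set.nonempty_coe_sort.1 (hJ.2.2 v).nonempty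
    obtain ⟨t, ht, hts⟩ := exists_top _ (hJ.2.2 v).preconnected.walkConnected hne
    exact ⟨t, ht, hts⟩
  choose top top_mem top_anc using bags
  let e := Fintype.equivFin (Set.range top)
  have : Nonempty (Fin (Fintype.card (Set.range top))) :=
    ⟨e ⟨_, Set.mem_range_self (Classical.arbitrary V)⟩⟩
  obtain ⟨R, hR, hdepth⟩ := RTree.exists_of_forest (fun i j => anc (e.symm i) (e.symm j))
    (fun i => lev (e.symm i)) (Nat.log 2 k) (fun u v w => chain _ _ _)
    (fun u v h hne => lev_lt _ _ h
      fun h' => hne (e.symm.injective (Subtype.ext h')))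
    (fun v => lev_le _)
  refine ⟨_, fun v => e ⟨top v, v, rfl⟩, R, ?_, ?_, ?_, by omega, ?_⟩
  · exact (Fintype.card_le_of_injective _ Subtype.val_injective).trans_eq (Fintype.card_fin k)
  · intro i
    obtain ⟨v, hv⟩ := (e.symm i).2
    exact ⟨v, by rw [← Equiv.eq_symm_apply]; exact Subtype.ext hv⟩
  · refine fun i => ⟨e.symm i, ?_⟩
    rintro v rfl
    simpa using top_mem v
  · intro a c w
    obtain ⟨t, ⟨x, hx, hxt⟩, ht⟩ := exists_top _ (hJ.walkConnected_support w)
      ⟨top a, a, w.start_mem_support, top_mem a⟩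
    have htx : top x = t := by
      by_contra hne
      exact lt_asymm (lev_lt _ _ (top_anc x t hxt) hne)
        (lev_lt _ _ (ht _ ⟨x, hx, top_mem x⟩) (Ne.symm hne))
    have anc_of_mem : ∀ y ∈ w.support, anc (top x) (top y) := fun y hy =>
      htx ▸ ht _ ⟨y, hy, top_mem y⟩
    exact ⟨x, hx, hR _ _ (by simpa using anc_of_mem a w.start_mem_support),
      hR _ _ (by simpa using anc_of_mem c w.end_mem_support)⟩
end

section
/- Let the index set {1,…,N} be partitioned into nonempty blocks B_1,…,B_b, let 𝒯 be a rooted tree on {1,…,b}, and suppose the indices are in elimination order. Let M ∈ ℝ^{N×N} be symmetric positive semidefinite such that M_{B_i,B_j} = 0 whenever i ≠ j and i, j are not comparable in 𝒯. Then there exists a lower-triangular matrix L ∈ ℝ^{N×N} with M = LLᵀ which is 𝒯-compatible, i.e., L_{B_i,B_j} = 0 whenever i is not a weak ancestor of j. -/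
/-- A positive semidefinite real matrix with a zero diagonal entry has a zero column there. -/
lemma Matrix.PosSemidef.apply_eq_zero_of_diag_eq_zero_s6 {n : Type*} [Fintype n] [DecidableEq n]
    {M : Matrix n n ℝ} (hM : M.PosSemidef) {q : n} (hq : M q q = 0) (p : n) : M p q = 0 := by
  have h := (hM.dotProduct_mulVec_zero_iff (Pi.single q 1)).1 (by simp [hq])
  simpa using congrFun h p

/-- One step of symmetric elimination preserves positive semidefiniteness. -/
lemma Matrix.PosSemidef.sub_col_mul_col_div_diag {n : Type*} [Fintype n] [DecidableEq n]
    {M : Matrix n n ℝ} (hM : M.PosSemidef) (q : n) :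
    (Matrix.of fun p s => M p s - M p q * M s q / M q q).PosSemidef := by
  have hsymm : ∀ p s, M p s = M s p := fun p s => by simpa using hM.1.apply s p
  by_cases hq : M q q = 0
  · convert hM using 1
    ext p s
    simp [hq]
  let E : Matrix n n ℝ := 1 - Matrix.of fun p s => if p = q then M s q / M q q else 0
  convert hM.conjTranspose_mul_mul_same E using 1
  have hME : M * E = Matrix.of fun p s => M p s - M p q * M s q / M q q := by
    ext p s
    simp only [E, Matrix.mul_sub, Matrix.mul_one]
    simp [Matrix.mul_apply, mul_div_assoc]
  rw [Matrix.mul_assoc, hME]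
  ext p s
  simp only [E, Matrix.conjTranspose_sub, Matrix.conjTranspose_one, Matrix.sub_mul, Matrix.one_mul]
  simp only [Matrix.sub_apply, Matrix.of_apply, Matrix.mul_apply, Matrix.conjTranspose_apply,
    apply_ite star, star_trivial, ite_mul, zero_mul, Finset.sum_ite_eq', Finset.mem_univ, if_true]
  rw [hsymm q s, mul_div_cancel_left₀ _ hq]
  ring

/-- Cholesky factorization without fill-in: if the sparsity pattern `C` is a relation for which
the given order is a perfect elimination order, a positive semidefinite matrix supported
on the last `d` indices has a lower-triangular factor with the same pattern and support. -/
lemma exists_cholesky_of_perfect_elimination_aux {N : ℕ} (C : Fin N → Fin N → Prop)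
    (hC : ∀ q p s, q < p → q < s → C p q → C s q → C p s) (d : ℕ) :
    ∀ M : Matrix (Fin N) (Fin N) ℝ, M.PosSemidef → (∀ p q, ¬ C p q → M p q = 0) →
      (∀ p q : Fin N, (p : ℕ) + d < N → M p q = 0) →
      ∃ L : Matrix (Fin N) (Fin N) ℝ, (∀ p q, p < q → L p q = 0) ∧
        M = L * L.transpose ∧ (∀ p q, ¬ C p q → L p q = 0) ∧
        ∀ p q : Fin N, (q : ℕ) + d < N → L p q = 0 := by
  induction d with
  | zero =>
    intro M _ _ h0
    refine ⟨0, by simp, ?_, by simp, by simp⟩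
    ext p q
    simpa using h0 p q (by simp)
  | succ d ih =>
    intro M hM hMC h0
    by_cases hd : N ≤ d
    · obtain ⟨L, h1, h2, h3, -⟩ := ih M hM hMC (fun p q h => by omega)
      exact ⟨L, h1, h2, h3, fun p q h => by omega⟩
    obtain ⟨q, hq⟩ : ∃ q : Fin N, (q : ℕ) + d + 1 = N := ⟨⟨N - d - 1, by omega⟩, by simp; omega⟩
    have hsymm : ∀ p s, M p s = M s p := fun p s => by simpa using hM.1.apply s p
    have hcol : ∀ p, p < q → M p q = 0 := fun p hp => h0 p q (by rw [Fin.lt_def] at hp; omega)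
    have hdiag : ∀ p, M p q * M q q / M q q = M p q := fun p => by
      by_cases h : M q q = 0
      · simp [h, hM.apply_eq_zero_of_diag_eq_zero_s6 h p]
      · field_simp
    obtain ⟨L, h1, h2, h3, h4⟩ := ih (Matrix.of fun p s => M p s - M p q * M s q / M q q)
      (hM.sub_col_mul_col_div_diag q) (by
        intro p s hps
        rw [Matrix.of_apply, hMC p s hps, zero_sub, neg_eq_zero]
        by_cases hp : M p q = 0
        · simp [hp]
        by_cases hs : M s q = 0
        · simp [hs]
        have hpq : q ≤ p := not_lt.1 fun h => hp (hcol p h)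
        have hsq : q ≤ s := not_lt.1 fun h => hs (hcol s h)
        have hCp : C p q := not_not.1 fun h => hp (hMC p q h)
        have hCs : C s q := not_not.1 fun h => hs (hMC s q h)
        rcases hpq.eq_or_lt with rfl | hpq
        · exact absurd (hsymm s q ▸ hMC q s hps) hs
        rcases hsq.eq_or_lt with rfl | hsq
        · exact absurd hCp hps
        exact absurd (hC q p s hpq hsq hCp hCs) hps) (by
        intro p s hp
        rw [Matrix.of_apply]
        by_cases hpq : p = q
        · subst hpq
          rw [mul_comm, hdiag, hsymm, sub_self]
        · have : (p : ℕ) ≠ q := fun h => hpq (Fin.ext h)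
          rw [h0 p s (by omega), h0 p q (by omega)]
          simp)
    have h4q : ∀ p, L p q = 0 := fun p => h4 p q (by omega)
    refine ⟨L + Matrix.of fun p r => if r = q then M p q / √(M q q) else 0, ?_, ?_, ?_, ?_⟩
    · intro p r hpr
      by_cases hr : r = q
      · subst hr
        simp [h4q, hcol p hpr]
      · simp [hr, h1 p r hpr]
    · ext p s
      have h := congrFun (congrFun h2 p) s
      rw [Matrix.of_apply, Matrix.mul_apply] at h
      have hsq : √(M q q) * √(M q q) = M q q := Real.mul_self_sqrt hM.diag_nonneg
      simp only [Matrix.mul_apply, Matrix.transpose_apply, Matrix.add_apply, Matrix.of_apply,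
        add_mul, mul_add, Finset.sum_add_distrib, mul_ite, ite_mul, mul_zero, zero_mul,
        Finset.sum_ite_eq', Finset.mem_univ, if_true, h4q] at h ⊢
      rw [← h, div_mul_div_comm, hsq]
      ring
    · intro p r hpr
      by_cases hr : r = q
      · subst hr
        simp [h4q, hMC p r hpr]
      · simp [hr, h3 p r hpr]
    · intro p r hr
      have : r ≠ q := by rintro rfl; omega
      simp [this, h4 p r (by omega)]

/-- Cholesky factorization of a positive semidefinite matrix without fill-in, for a sparsity
pattern `C` with a perfect elimination order. -/
lemma exists_cholesky_of_perfect_elimination {N : ℕ} (C : Fin N → Fin N → Prop)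
    (hC : ∀ q p s, q < p → q < s → C p q → C s q → C p s)
    {M : Matrix (Fin N) (Fin N) ℝ} (hM : M.PosSemidef) (hMC : ∀ p q, ¬ C p q → M p q = 0) :
    ∃ L : Matrix (Fin N) (Fin N) ℝ, (∀ p q, p < q → L p q = 0) ∧
      M = L * L.transpose ∧ ∀ p q, ¬ C p q → L p q = 0 := by
  obtain ⟨L, h1, h2, h3, -⟩ := exists_cholesky_of_perfect_elimination_aux C hC N M hM hMC
    (fun p q h => by omega)
  exact ⟨L, h1, h2, h3⟩

/-- Two weak ancestors of the same vertex are comparable. -/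
lemma RTree.comparable_of_weakAncestor_s6 {V : Type*} (T : RTree V) {u v w : V}
    (hu : T.weakAncestor u w) (hv : T.weakAncestor v w) : T.comparable u v := by
  obtain ⟨k, rfl⟩ := hu
  obtain ⟨l, rfl⟩ := hv
  rcases le_total k l with h | h
  · exact .inr ⟨l - k, by rw [← Function.iterate_add_apply, Nat.sub_add_cancel h]⟩
  · exact .inl ⟨k - l, by rw [← Function.iterate_add_apply, Nat.sub_add_cancel h]⟩

theorem stmt6 {N b : ℕ}
    (B : Fin b → Finset (Fin N))
    (hBne : ∀ i : Fin b, (B i).Nonempty)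
    (hBdisj : ∀ i j : Fin b, i ≠ j → Disjoint (B i) (B j))
    (hBcover : ∀ p : Fin N, ∃ i : Fin b, p ∈ B i)
    (𝒯 : RTree (Fin b))
    (helim : ∀ i j : Fin b, 𝒯.properAncestor j i →
      ∀ p ∈ B i, ∀ q ∈ B j, p < q)
    (M : Matrix (Fin N) (Fin N) ℝ)
    (hM : M.PosSemidef)
    (hMsparse : ∀ i j : Fin b, i ≠ j → ¬ 𝒯.comparable i j →
      ∀ p ∈ B i, ∀ q ∈ B j, M p q = 0) :
    ∃ L : Matrix (Fin N) (Fin N) ℝ,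
      (∀ p q : Fin N, p < q → L p q = 0) ∧
      M = L * L.transpose ∧
      ∀ i j : Fin b, ¬ 𝒯.weakAncestor i j → ∀ p ∈ B i, ∀ q ∈ B j, L p q = 0 := by

  choose β hβ using hBcover
  have huniq : ∀ i p, p ∈ B i → β p = i := fun i p hp => by
    by_contra h
    exact Finset.disjoint_left.1 (hBdisj _ _ h) (hβ p) hp
  have hanc : ∀ p q, q ≤ p → 𝒯.comparable (β p) (β q) → 𝒯.weakAncestor (β p) (β q) := by
    rintro p q hqp (h | h)
    · exact h
    by_cases he : β q = β p
    · exact ⟨0, he⟩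
    · exact absurd (helim _ _ ⟨h, he⟩ p (hβ p) q (hβ q)) (not_lt.2 hqp)
  obtain ⟨L, h1, h2, h3⟩ := exists_cholesky_of_perfect_elimination
    (fun p q => 𝒯.comparable (β p) (β q))
    (fun q p s hp hs hpq hsq => 𝒯.comparable_of_weakAncestor_s6 (hanc p q hp.le hpq)
      (hanc s q hs.le hsq)) hM
    (fun p q h => hMsparse _ _ (fun he => h (.inl ⟨0, he.symm⟩)) h p (hβ p) q (hβ q))
  refine ⟨L, h1, h2, fun i j hij p hp q hq => ?_⟩
  obtain rfl := huniq i p hp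
  obtain rfl := huniq j q hq
  rcases lt_or_ge p q with h | h
  · exact h1 p q h
  · exact h3 p q fun hc => hij (hanc p q h hc)
end

section
/- Let the index set {1,…,N} be partitioned into nonempty blocks B_1,…,B_b and let 𝒯 be a rooted tree on {1,…,b}. If L ∈ ℝ^{N×N} is an invertible lower-triangular 𝒯-compatible matrix, then L^{-1} is also lower-triangular and 𝒯-compatible; that is, (L^{-1})_{B_i,B_j} = 0 whenever i is not a weak ancestor of j in 𝒯. -/
theorem RTree.weakAncestor_refl_s8 {V : Type*} (T : RTree V) (v : V) : T.weakAncestor v v :=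
  ⟨0, rfl⟩

theorem RTree.weakAncestor_trans {V : Type*} (T : RTree V) {u v w : V}
    (huv : T.weakAncestor u v) (hvw : T.weakAncestor v w) : T.weakAncestor u w := by
  obtain ⟨k, rfl⟩ := huv
  obtain ⟨l, rfl⟩ := hvw
  exact ⟨k + l, Function.iterate_add_apply _ _ _ _⟩

/-- If an invertible matrix is supported on a reflexive and transitive relation, so is its
inverse. -/
theorem Matrix.inv_apply_eq_zero_of_not_rel {n R : Type*} [Fintype n] [DecidableEq n]
    [CommRing R] {M : Matrix n n R} (hM : IsUnit M.det) {r : n → n → Prop}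
    (hrefl : ∀ p, r p p) (htrans : ∀ p q s, r p q → r q s → r p s)
    (hsupp : ∀ p q, ¬ r p q → M p q = 0) {p q : n} (hpq : ¬ r p q) : M⁻¹ p q = 0 := by
  classical
  have : Invertible M := M.invertibleOfIsUnitDet hM
  have hblock : M.BlockTriangular fun x => if r x q then 0 else 1 := by
    intro x y hxy
    refine hsupp x y fun hr => ?_
    by_cases hy : r y q
    · simp [hy, htrans x y q hr hy] at hxy
    · by_cases hx : r x q <;> simp [hx, hy] at hxy
  exact Matrix.blockTriangular_inv_of_blockTriangular hblock (by simp [hpq, hrefl])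

theorem stmt8 {N b : ℕ}
    (B : Fin b → Finset (Fin N))
    (hBne : ∀ i : Fin b, (B i).Nonempty)
    (hBdisj : ∀ i j : Fin b, i ≠ j → Disjoint (B i) (B j))
    (hBcover : ∀ p : Fin N, ∃ i : Fin b, p ∈ B i)
    (𝒯 : RTree (Fin b))
    (L : Matrix (Fin N) (Fin N) ℝ)
    (hLinv : IsUnit L.det)
    (hLlow : ∀ p q : Fin N, p < q → L p q = 0)
    (hLcompat : ∀ i j : Fin b, ¬ 𝒯.weakAncestor i j →
      ∀ p ∈ B i, ∀ q ∈ B j, L p q = 0) :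
    (∀ p q : Fin N, p < q → L⁻¹ p q = 0) ∧
    (∀ i j : Fin b, ¬ 𝒯.weakAncestor i j →
      ∀ p ∈ B i, ∀ q ∈ B j, L⁻¹ p q = 0) := by
  refine ⟨fun p q hpq => ?_, fun i j hij p hp q hq => ?_⟩
  · exact Matrix.inv_apply_eq_zero_of_not_rel hLinv (r := fun p q => q ≤ p) (fun _ => le_rfl)
      (fun _ _ _ h h' => h'.trans h) (fun p q h => hLlow p q (not_le.mp h)) (not_le.mpr hpq)
  · choose block hblock using hBcover
    have block_eq : ∀ {k x}, x ∈ B k → block x = k := fun {k x} hx => by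
      by_contra hne
      exact Finset.disjoint_left.mp (hBdisj _ _ hne) (hblock x) hx
    refine Matrix.inv_apply_eq_zero_of_not_rel hLinv
      (r := fun p q => 𝒯.weakAncestor (block p) (block q)) (fun _ => 𝒯.weakAncestor_refl_s8 _)
      (fun _ _ _ => 𝒯.weakAncestor_trans)
      (fun p q h => hLcompat _ _ h p (hblock p) q (hblock q)) ?_
    rwa [block_eq hp, block_eq hq]
end

section
/- Let the index set {1,…,N} be partitioned into nonempty blocks B_1,…,B_b with rooted tree 𝒯 on {1,…,b}, and let L ∈ ℝ^{N×N} be invertible, lower-triangular and 𝒯-compatible. Fix v ∈ {1,…,b} and let S = ⋃_{j a weak ancestor of v} B_j. Then L_{p,q} = 0 and (L^{-1})_{p,q} = 0 for every q ∈ S and p ∉ S. Consequently, the principal submatrix L_{S,S} is invertible and, for every w ∈ ℝ^N, the restriction of L^{-ᵀ}w to the coordinates in S equals (L_{S,S})^{-ᵀ} applied to the restriction of w to S; in particular (L^{-ᵀ}w)|_S depends only on w|_S. -/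
namespace Matrix

variable {n R : Type*} [Fintype n] [DecidableEq n] [CommRing R]

/-- The inverse of an invertible matrix vanishing on the rows outside `S` and the columns in `S`
vanishes there too. -/
theorem inv_apply_eq_zero_of_mem_of_notMem {L : Matrix n n R} (hL : IsUnit L.det) {S : Finset n}
    (h : ∀ p q, q ∈ S → p ∉ S → L p q = 0) {p q : n} (hq : q ∈ S) (hp : p ∉ S) :
    L⁻¹ p q = 0 := by
  have := L.invertibleOfIsUnitDet hL
  have hT : L.BlockTriangular (fun p => if p ∈ S then 0 else 1 : n → ℕ) := by
    intro i j hij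
    by_cases hi : i ∈ S <;> by_cases hj : j ∈ S <;> simp [hi, hj] at hij
    exact h i j hj hi
  exact blockTriangular_inv_of_blockTriangular hT (by simp [hp, hq])

theorem submatrix_mul_inv_submatrix {L : Matrix n n R} (hL : IsUnit L.det) {S : Finset n}
    (h : ∀ p q, q ∈ S → p ∉ S → L p q = 0) :
    L.submatrix (Subtype.val : {p // p ∈ S} → n) (Subtype.val : {p // p ∈ S} → n) *
      L⁻¹.submatrix (Subtype.val : {p // p ∈ S} → n)
        (Subtype.val : {p // p ∈ S} → n) = 1 := by
  ext i j
  have hij := congrFun₂ (mul_nonsing_inv L hL) i.val j.val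
  rw [mul_apply, ← Finset.sum_subset S.subset_univ fun q _ hq => by
    rw [inv_apply_eq_zero_of_mem_of_notMem hL h j.2 hq, mul_zero]] at hij
  rw [mul_apply]
  simp only [submatrix_apply]
  rw [Finset.sum_coe_sort S fun q => L i q * L⁻¹ q j, hij]
  simp only [one_apply, Subtype.ext_iff]

end Matrix

theorem stmt9 {N b : ℕ}
    (B : Fin b → Finset (Fin N))
    (hBne : ∀ i : Fin b, (B i).Nonempty)
    (hBdisj : ∀ i j : Fin b, i ≠ j → Disjoint (B i) (B j))
    (hBcover : ∀ p : Fin N, ∃ i : Fin b, p ∈ B i)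
    (𝒯 : RTree (Fin b))
    (L : Matrix (Fin N) (Fin N) ℝ)
    (hLinv : IsUnit L.det)
    (hLlow : ∀ p q : Fin N, p < q → L p q = 0)
    (hLcompat : ∀ i j : Fin b, ¬ 𝒯.weakAncestor i j →
      ∀ p ∈ B i, ∀ q ∈ B j, L p q = 0)
    (v : Fin b)
    (S : Finset (Fin N))
    (hS : ∀ p : Fin N, p ∈ S ↔ ∃ j : Fin b, 𝒯.weakAncestor j v ∧ p ∈ B j)
    (LS : Matrix {p : Fin N // p ∈ S} {p : Fin N // p ∈ S} ℝ)
    (hLS : LS = L.submatrix Subtype.val Subtype.val) :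
    (∀ p q : Fin N, q ∈ S → p ∉ S → L p q = 0 ∧ L⁻¹ p q = 0) ∧
    IsUnit LS.det ∧
    ∀ (w : Fin N → ℝ) (p : Fin N) (hp : p ∈ S),
      (L⁻¹).transpose.mulVec w p =
        (LS⁻¹).transpose.mulVec (fun q : {p : Fin N // p ∈ S} => w q.val) ⟨p, hp⟩ := by
  have hzero : ∀ p q : Fin N, q ∈ S → p ∉ S → L p q = 0 := by
    intro p q hq hp
    obtain ⟨j, hjv, hqj⟩ := (hS q).1 hq
    obtain ⟨i, hpi⟩ := hBcover p
    exact hLcompat i j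
      (fun hij => hp ((hS p).2 ⟨i, 𝒯.weakAncestor_trans hij hjv, hpi⟩)) p hpi q hqj
  have hinv : ∀ p q : Fin N, q ∈ S → p ∉ S → L⁻¹ p q = 0 := fun p q hq hp =>
    Matrix.inv_apply_eq_zero_of_mem_of_notMem hLinv hzero hq hp
  have hmul := Matrix.submatrix_mul_inv_submatrix hLinv hzero
  rw [← hLS] at hmul
  refine ⟨fun p q hq hp => ⟨hzero p q hq hp, hinv p q hq hp⟩,
    Matrix.isUnit_det_of_right_inverse hmul, fun w p hp => ?_⟩
  rw [Matrix.inv_eq_right_inv hmul]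
  simp only [Matrix.mulVec, dotProduct, Matrix.transpose_apply, Matrix.submatrix_apply]
  rw [Finset.sum_coe_sort S fun q => L⁻¹ q p * w q]
  exact (Finset.sum_subset S.subset_univ fun q _ hq => by rw [hinv q p hp hq, zero_mul]).symm
end

section
/- Let A_1,…,A_m ∈ ℝ^{n×n} be linearly independent symmetric matrices and let G be a finite simple graph on {1,…,n} admitting a tree decomposition in which every bag has size at most τ. Suppose that for each i ∈ {1,…,m}, every pair of distinct vertices u, v ∈ supp(A_i) is an edge of G, where supp(A_i) := {u ∈ {1,…,n} : the u-th row of A_i is nonzero}. Then m ≤ τ·n. -/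
namespace SimpleGraph

variable {ι : Type*} {T : SimpleGraph ι}

/-- In a tree, every vertex has at most one neighbour closer to the root `r`. -/
theorem IsTree.eq_of_adj_of_dist_add_one_eq (hT : T.IsTree) {r t x y : ι}
    (hx : T.Adj x t) (hy : T.Adj y t)
    (hxd : T.dist r x + 1 = T.dist r t) (hyd : T.dist r y + 1 = T.dist r t) : x = y := by
  obtain ⟨p, -, hp⟩ := hT.connected.exists_path_of_dist r x
  obtain ⟨q, -, hq⟩ := hT.connected.exists_path_of_dist r y
  have hp' : (p.concat hx).IsPath :=
    Walk.isPath_of_length_eq_dist _ (by rw [Walk.length_concat, hp, hxd])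
  have hq' : (q.concat hy).IsPath :=
    Walk.isPath_of_length_eq_dist _ (by rw [Walk.length_concat, hq, hyd])
  exact (Walk.concat_inj ((hT.existsUnique_path r t).unique hp' hq')).1

/-- A path in a tree either visits the parent of its starting vertex or descends from it. -/
theorem IsTree.exists_parent_mem_support_or_dist_eq (hT : T.IsTree) (r : ι) {t s : ι}
    (w : T.Walk t s) (hw : w.IsPath) :
    (∃ x ∈ w.support, T.Adj x t ∧ T.dist r x + 1 = T.dist r t) ∨
      T.dist r s = T.dist r t + w.length := by
  induction w with
  | nil => simp
  | @cons t c s h w ih =>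
    rw [Walk.cons_isPath_iff] at hw
    rcases hT.dist_eq_dist_add_one_of_adj r h with hd | hd
    · exact Or.inl ⟨c, by simp, h.symm, hd.symm⟩
    · rcases ih hw.1 with ⟨x, hx, hxc, hxd⟩ | hlen
      · have := hT.eq_of_adj_of_dist_add_one_eq hxc h hxd hd.symm
        exact absurd (this ▸ hx) hw.2
      · right
        rw [Walk.length_cons]
        omega

/-- Two vertices of a connected vertex set are joined by a path inside the set. -/
theorem exists_isPath_support_subset_of_connected_induce {S : Set ι}
    (hS : (T.induce S).Connected) {t s : ι} (ht : t ∈ S) (hs : s ∈ S) :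
    ∃ w : T.Walk t s, w.IsPath ∧ ∀ x ∈ w.support, x ∈ S := by
  obtain ⟨p, hp⟩ := hS.exists_isPath ⟨t, ht⟩ ⟨s, hs⟩
  refine ⟨p.map (Embedding.induce S).toHom,
    hp.map (Embedding.induce (G := T) S).injective, ?_⟩
  intro x hx
  obtain ⟨y, -, rfl⟩ := List.mem_map.1
    (Walk.support_map (Embedding.induce S).toHom p ▸ hx)
  exact y.2

/-- If two connected vertex sets of a tree meet, then the one whose top vertex is nearer to the
root contains the top vertex of the other one. -/
theorem IsTree.top_mem_of_connected_induce (hT : T.IsTree) (r : ι) {S S' : Set ι}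
    (hS : (T.induce S).Connected) (hS' : (T.induce S').Connected) {a b t : ι}
    (ha : a ∈ S) (hb : b ∈ S') (hmin : ∀ x ∈ S, T.dist r a ≤ T.dist r x)
    (hab : T.dist r b ≤ T.dist r a) (ht : t ∈ S) (ht' : t ∈ S') : a ∈ S' := by
  induction hd : T.dist r t generalizing t with
  | zero =>
    have h1 := hmin t ht
    have h2 : r = t := (hT.connected r t).dist_eq_zero_iff.1 hd
    have h3 : r = a := (hT.connected r a).dist_eq_zero_iff.1 (by omega)
    rwa [← h3, h2]
  | succ d ih =>
    obtain ⟨w, hw, hwS⟩ := exists_isPath_support_subset_of_connected_induce hS ht ha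
    obtain ⟨w', hw', hwS'⟩ := exists_isPath_support_subset_of_connected_induce hS' ht' hb
    have hle := hmin t ht
    rcases hT.exists_parent_mem_support_or_dist_eq r w hw with ⟨x, hx, hxt, hxd⟩ | h
    · have hax := hmin x (hwS x hx)
      rcases hT.exists_parent_mem_support_or_dist_eq r w' hw' with ⟨y, hy, hyt, hyd⟩ | h'
      · have hxy := hT.eq_of_adj_of_dist_add_one_eq hxt hyt hxd hyd
        exact ih (hwS x hx) (hxy ▸ hwS' y hy) (by omega)
      · omega
    · have hta : t = a := Walk.eq_of_length_eq_zero (p := w) (by omega)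
      rwa [← hta]

end SimpleGraph

/-- A tree decomposition assigns to every vertex a bag containing it so that each edge has an
endpoint whose bag contains the other endpoint. -/
theorem IsTreeDecomp.exists_bag_assignment {V ι : Type*} {G : SimpleGraph V} {T : SimpleGraph ι}
    {J : ι → Finset V} (h : IsTreeDecomp G T J) :
    ∃ f : V → ι, (∀ v, v ∈ J (f v)) ∧ ∀ u v, G.Adj u v → v ∈ J (f u) ∨ u ∈ J (f v) := by
  obtain ⟨hT, hedge, hconn⟩ := h
  obtain ⟨r⟩ := hT.connected.nonempty
  have htop : ∀ v, ∃ t, v ∈ J t ∧ ∀ x, v ∈ J x → T.dist r t ≤ T.dist r x := by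
    intro v
    obtain ⟨⟨s, hs⟩⟩ := (hconn v).nonempty
    exact ⟨Function.argminOn (T.dist r) {t | v ∈ J t} ⟨s, hs⟩,
      Function.argminOn_mem (T.dist r) {t | v ∈ J t} _,
      fun x hx => Function.argminOn_le (T.dist r) {t | v ∈ J t} hx⟩
  choose f hf hmin using htop
  refine ⟨f, hf, fun u v huv => ?_⟩
  obtain ⟨t, htu, htv⟩ := hedge u v huv
  rcases le_total (T.dist r (f v)) (T.dist r (f u)) with hle | hle
  · exact Or.inl (hT.top_mem_of_connected_induce r (hconn u) (hconn v) (hf u) (hf v) (hmin u)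
      hle htu htv)
  · exact Or.inr (hT.top_mem_of_connected_induce r (hconn v) (hconn u) (hf v) (hf u) (hmin v)
      hle htv htu)

/-- A linearly independent family of symmetric matrices has at most as many members as there are
positions in a set `S` which contains, up to transposition, every nonzero position. -/
theorem Matrix.card_le_of_linearIndependent_of_isSymm {K n κ : Type*} [Field K] [Fintype κ]
    {A : κ → Matrix n n K} (hsym : ∀ i, (A i).IsSymm) (hind : LinearIndependent K A)
    (S : Finset (n × n)) (hS : ∀ i u v, A i u v ≠ 0 → (u, v) ∈ S ∨ (v, u) ∈ S) :
    Fintype.card κ ≤ S.card := by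
  let φ : Matrix n n K →ₗ[K] (S → K) :=
    { toFun := fun M p => M p.1.1 p.1.2
      map_add' := fun _ _ => rfl
      map_smul' := fun _ _ => rfl }
  have hspan : ∀ M ∈ Submodule.span K (Set.range A),
      M.IsSymm ∧ ∀ u v, (u, v) ∉ S → (v, u) ∉ S → M u v = 0 := by
    intro M hM
    induction hM using Submodule.span_induction with
    | mem M hM =>
      obtain ⟨i, rfl⟩ := hM
      refine ⟨hsym i, fun u v h1 h2 => ?_⟩
      by_contra h
      exact (hS i u v h).elim h1 h2
    | zero => exact ⟨Matrix.isSymm_zero, fun _ _ _ _ => rfl⟩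
    | add M N _ _ hM hN =>
      refine ⟨hM.1.add hN.1, fun u v h1 h2 => ?_⟩
      rw [Matrix.add_apply, hM.2 u v h1 h2, hN.2 u v h1 h2, add_zero]
    | smul c M _ hM =>
      refine ⟨hM.1.smul c, fun u v h1 h2 => ?_⟩
      rw [Matrix.smul_apply, hM.2 u v h1 h2, smul_zero]
  have hdisj : Disjoint (Submodule.span K (Set.range A)) (LinearMap.ker φ) := by
    rw [Submodule.disjoint_def]
    intro M hM hker
    have hz : ∀ u v, (u, v) ∈ S → M u v = 0 := fun u v h =>
      congrFun (LinearMap.mem_ker.1 hker) ⟨(u, v), h⟩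
    ext u v
    by_cases h1 : (u, v) ∈ S
    · exact hz u v h1
    by_cases h2 : (v, u) ∈ S
    · rw [← (hspan M hM).1.apply u v]
      exact hz v u h2
    · exact (hspan M hM).2 u v h1 h2
  simpa using (hind.map hdisj).fintype_card_le_finrank

theorem stmt10 {n m k : ℕ} (G : SimpleGraph (Fin n))
    (T : SimpleGraph (Fin k)) (J : Fin k → Finset (Fin n)) (τ : ℕ)
    (hTD : IsTreeDecomp G T J)
    (hbag : ∀ t : Fin k, (J t).card ≤ τ)
    (A : Fin m → Matrix (Fin n) (Fin n) ℝ)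
    (hsym : ∀ i : Fin m, (A i).IsSymm)
    (hind : LinearIndependent ℝ A)
    (hsupp : ∀ (i : Fin m) (u v : Fin n), u ≠ v →
      (∃ z : Fin n, A i u z ≠ 0) → (∃ z : Fin n, A i v z ≠ 0) → G.Adj u v) :
    m ≤ τ * n := by
  obtain ⟨f, hf, hedge⟩ := hTD.exists_bag_assignment
  let S : Finset (Fin n × Fin n) := Finset.univ.filter fun p => p.2 ∈ J (f p.1)
  have hS : S.card ≤ τ * n := by
    have hle : S.card ≤ τ * (Finset.univ : Finset (Fin n)).card := by
      refine Finset.card_le_mul_card_image_of_maps_to (f := Prod.fst)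
        (fun _ _ => Finset.mem_univ _) τ fun u _ => ?_
      refine le_trans (Finset.card_le_card_of_injOn Prod.snd ?_ ?_) (hbag (f u))
      · rintro ⟨a, b⟩ hab
        simp only [S, Finset.coe_filter, Finset.mem_filter, Finset.mem_univ, true_and,
          Set.mem_ofPred_eq] at hab
        obtain ⟨hb, rfl⟩ := hab
        exact hb
      · rintro ⟨a, b⟩ hab ⟨c, d⟩ hcd hbd
        simp only [Finset.coe_filter, Set.mem_ofPred_eq] at hab hcd
        exact Prod.ext (hab.2.trans hcd.2.symm) hbd
    simpa using hle
  refine le_trans ?_ hS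
  have hcard := Matrix.card_le_of_linearIndependent_of_isSymm hsym hind S ?_
  · simpa using hcard
  · intro i u v huv
    simp only [S, Finset.mem_filter, Finset.mem_univ, true_and]
    by_cases h : u = v
    · exact Or.inl (h ▸ hf u)
    · exact hedge u v (hsupp i u v h ⟨v, huv⟩ ⟨u, by rwa [(hsym i).apply]⟩)
end

section
/- Let 𝒯 be a rooted tree on the vertex set {1,…,m} whose labeling is a depth-first pre-order, i.e., for every vertex v the set of weak descendants of v equals the interval {v, v+1, …, v + s_v − 1}, where s_v is the number of weak descendants of v. For a vertex x write anc*(x) for the set of weak ancestors of x. Let I = {a, a+1, …, c} ⊆ {1,…,m} be a nonempty interval with I ≠ {1,…,m}. Then (⋃_{i∈I} anc*(i)) ∩ (⋃_{j∉I} anc*(j)) ⊆ anc*(a−1) ∪ anc*(c+1), where anc*(0) and anc*(m+1) are interpreted as the empty set. In particular, this intersection is contained in the union of at most two root-to-vertex paths of 𝒯. -/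
theorem stmt11 {m : ℕ} (𝒯 : RTree (Fin m))
    (hpre : ∀ v : Fin m, ∃ s : ℕ, ∀ u : Fin m,
      𝒯.weakAncestor v u ↔ v.val ≤ u.val ∧ u.val < v.val + s)
    (a c : Fin m) (hac : a ≤ c)
    (hI : ¬ (a.val = 0 ∧ c.val = m - 1))
    (u : Fin m)
    (hin : ∃ i : Fin m, a ≤ i ∧ i ≤ c ∧ 𝒯.weakAncestor u i)
    (hout : ∃ j : Fin m, (j < a ∨ c < j) ∧ 𝒯.weakAncestor u j) :
    (∃ _ : 0 < a.val,
      𝒯.weakAncestor u ⟨a.val - 1, Nat.lt_of_le_of_lt (Nat.sub_le a.val 1) a.isLt⟩) ∨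
    (∃ h : c.val + 1 < m, 𝒯.weakAncestor u ⟨c.val + 1, h⟩) := by
  obtain ⟨s, hs⟩ := hpre u
  obtain ⟨i, hai, hic, hui⟩ := hin
  obtain ⟨j, hj, huj⟩ := hout
  simp only [hs, Fin.le_def, Fin.lt_def] at *
  rcases hj with hj | hj
  · exact Or.inl ⟨by omega, by omega, by omega⟩
  · exact Or.inr ⟨by omega, by omega, by omega⟩
end

section
/- Let R be a finite rooted tree in which every vertex has at most d children, and let each vertex v carry a real weight w_v with 0 < w_v ≤ τ; set m = Σ_v w_v. Then there is a partition of the vertices of R into parts, each part inducing a connected subgraph of R, such that: contracting each part to a single node yields a rooted tree R' whose depth is at most the depth of R; every part has total weight at most (d+1)·τ; every part other than the part containing the root of R has total weight at least τ; and consequently the number of parts is at most m/τ + 1. -/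
namespace RTree

variable {V : Type*}

open Classical in
/-- The distance from `v` to the root. -/
noncomputable def level (T : RTree V) (v : V) : ℕ := Nat.find (T.reaches_root v)

theorem level_parent_lt (T : RTree V) {v : V} (hv : v ≠ T.root) :
    T.level (T.parent v) < T.level v := by
  classical
  have h : T.parent^[T.level v] v = T.root := Nat.find_spec (T.reaches_root v)
  rcases hk : T.level v with _ | k
  · rw [hk] at h
    exact absurd h hv
  · rw [hk, Function.iterate_succ_apply] at h
    exact Nat.lt_succ_of_le (Nat.find_min' (T.reaches_root (T.parent v)) h)

theorem parent_ne_self (T : RTree V) {v : V} (hv : v ≠ T.root) : T.parent v ≠ v := fun h => by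
  have := T.level_parent_lt hv
  rw [h] at this
  exact lt_irrefl _ this

theorem induction_from_root (T : RTree V) {Q : V → Prop} (root : Q T.root)
    (step : ∀ v, v ≠ T.root → Q (T.parent v) → Q v) (v : V) : Q v := by
  induction h : T.level v using Nat.strong_induction_on generalizing v with
  | _ n ih =>
    by_cases hv : v = T.root
    · exact hv ▸ root
    · exact step v hv (ih _ (h ▸ T.level_parent_lt hv) _ rfl)

open Classical in
/-- The lowest weak ancestor of `v` that is the root or does not satisfy `N`. -/
noncomputable def head (T : RTree V) (N : V → Prop) (v : V) : V :=
  if _h : v ≠ T.root ∧ N v then T.head N (T.parent v) else v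
termination_by T.level v
decreasing_by exact T.level_parent_lt _h.1

theorem head_of_pos (T : RTree V) {N : V → Prop} {v : V} (h : v ≠ T.root ∧ N v) :
    T.head N v = T.head N (T.parent v) := by
  rw [head, dif_pos h]

theorem head_of_neg (T : RTree V) {N : V → Prop} {v : V} (h : ¬(v ≠ T.root ∧ N v)) :
    T.head N v = v := by
  rw [head, dif_neg h]

theorem head_root (T : RTree V) (N : V → Prop) : T.head N T.root = T.root :=
  T.head_of_neg fun h => h.1 rfl

theorem not_head (T : RTree V) (N : V → Prop) (v : V) :
    ¬(T.head N v ≠ T.root ∧ N (T.head N v)) := by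
  induction v using T.induction_from_root with
  | root => rw [head_root]; exact fun h => h.1 rfl
  | step v _ ih =>
    by_cases h : v ≠ T.root ∧ N v
    · rwa [T.head_of_pos h]
    · rwa [T.head_of_neg h]

theorem head_head (T : RTree V) (N : V → Prop) (v : V) :
    T.head N (T.head N v) = T.head N v :=
  T.head_of_neg (T.not_head N v)

theorem exists_iterate_eq_head (T : RTree V) (N : V → Prop) (v : V) :
    ∃ k, T.parent^[k] v = T.head N v ∧ ∀ j ≤ k, T.head N (T.parent^[j] v) = T.head N v := by
  induction v using T.induction_from_root with
  | root => exact ⟨0, (T.head_root N).symm, fun j hj => by simp [Nat.le_zero.1 hj]⟩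
  | step v _ ih =>
    by_cases h : v ≠ T.root ∧ N v
    · obtain ⟨k, hk, hj⟩ := ih
      refine ⟨k + 1, by rw [Function.iterate_succ_apply, hk, T.head_of_pos h], fun j hjk => ?_⟩
      cases j with
      | zero => rfl
      | succ j => rw [Function.iterate_succ_apply, hj j (by omega), T.head_of_pos h]
    · exact ⟨0, (T.head_of_neg h).symm, fun j hj => by simp [Nat.le_zero.1 hj]⟩

/-- The weight of the part topped by a vertex when parts are cut off greedily from the leaves
upwards, as soon as they reach weight `τ`. -/
theorem exists_residual_weight [Fintype V] [DecidableEq V] (T : RTree V) (w : V → ℝ) (τ : ℝ) :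
    ∃ r : V → ℝ, ∀ v, r v = w v +
      ∑ c with T.parent c = v ∧ c ≠ T.root ∧ r c < τ, r c := by
  let M := Finset.univ.sup T.level
  have hM (v : V) : T.level v ≤ M := Finset.le_sup (Finset.mem_univ v)
  have wf : WellFounded fun c v : V => M - T.level c < M - T.level v :=
    (measure fun v => M - T.level v).wf
  have hlt {c v : V} (h : T.parent c = v ∧ c ≠ T.root) : M - T.level c < M - T.level v := by
    have h₁ := T.level_parent_lt h.2
    have h₂ := hM c
    rw [h.1] at h₁
    omega
  let F (v : V) (g : ∀ c, M - T.level c < M - T.level v → ℝ) : ℝ := w v +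
    ∑ c, if h : T.parent c = v ∧ c ≠ T.root then
      (if g c (hlt h) < τ then g c (hlt h) else 0) else 0
  refine ⟨wf.fix F, fun v => ?_⟩
  rw [wf.fix_eq, Finset.sum_filter]
  refine congrArg (w v + ·) (Finset.sum_congr rfl fun c _ => ?_)
  by_cases h : T.parent c = v ∧ c ≠ T.root
  · by_cases h' : wf.fix F c < τ
    · rw [dif_pos h, if_pos h', if_pos ⟨h.1, h.2, h'⟩]
    · rw [dif_pos h, if_neg h', if_neg fun h'' => h' h''.2.2]
  · rw [dif_neg h, if_neg fun h'' => h ⟨h''.1, h''.2.1⟩]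

theorem sum_head_eq [Fintype V] [DecidableEq V] (T : RTree V) (N : V → Prop)
    [DecidablePred N] {w r : V → ℝ}
    (hr : ∀ v, r v = w v + ∑ c with T.parent c = v ∧ c ≠ T.root ∧ N c, r c)
    {t : V} (ht : T.head N t = t) :
    ∑ u with T.head N u = t, w u = r t := by
  have hsum : ∑ u with T.head N u = t, ∑ c with T.parent c = u ∧ c ≠ T.root ∧ N c, r c =
      ∑ c with T.head N c = t ∧ (c ≠ T.root ∧ N c), r c := by
    rw [Finset.sum_comm' (t' := {c | T.head N c = t ∧ (c ≠ T.root ∧ N c)})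
      (s' := fun c => {T.parent c})]
    · simp
    · intro u c
      simp only [Finset.mem_filter, Finset.mem_univ, true_and, Finset.mem_singleton]
      constructor
      · rintro ⟨h, rfl, hc⟩
        exact ⟨rfl, (T.head_of_pos hc).trans h, hc⟩
      · rintro ⟨rfl, h, hc⟩
        exact ⟨(T.head_of_pos hc).symm.trans h, rfl, hc⟩
  have htop : ({u | T.head N u = t ∧ ¬(u ≠ T.root ∧ N u)} : Finset V) = {t} := by
    ext u
    simp only [Finset.mem_filter, Finset.mem_univ, true_and, Finset.mem_singleton]
    constructor
    · rintro ⟨h, hu⟩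
      rwa [T.head_of_neg hu] at h
    · rintro rfl
      exact ⟨ht, by have := T.not_head N u; rwa [ht] at this⟩
  have htot := Finset.sum_congr (rfl : ({u | T.head N u = t} : Finset V) = _) fun u _ => hr u
  rw [Finset.sum_add_distrib, hsum, ← Finset.sum_filter_add_sum_filter_not
    ({u | T.head N u = t} : Finset V) (fun u => u ≠ T.root ∧ N u) r,
    Finset.filter_filter, Finset.filter_filter, htop, Finset.sum_singleton] at htot
  linarith

/-- The rooted tree obtained by contracting the fibres of `f`, where `s p` is the top of `p`. -/
def contract {P : Type*} (T : RTree V) (f : V → P) (s : P → V) (hs : ∀ p, f (s p) = p)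
    (hroot : s (f T.root) = T.root)
    (hf : ∀ u, f (T.parent u) = f u ∨ s (f u) = u) : RTree P where
  root := f T.root
  parent p := f (T.parent (s p))
  parent_root := by rw [hroot, T.parent_root]
  reaches_root p := by
    rw [← hs p]
    induction s p using T.induction_from_root with
    | root => exact ⟨0, rfl⟩
    | step v _ ih =>
      obtain h | h := hf v
      · rwa [h] at ih
      · obtain ⟨k, hk⟩ := ih
        exact ⟨k + 1, by rw [Function.iterate_succ_apply, h, hk]⟩

theorem depth_contract_le {P : Type*} [Fintype V] [Fintype P] (T : RTree V) (f : V → P)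
    (s : P → V) (hs : ∀ p, f (s p) = p) (hroot : s (f T.root) = T.root)
    (hf : ∀ u, f (T.parent u) = f u ∨ s (f u) = u)
    (hanc : ∀ u, T.weakAncestor (s (f u)) u) :
    (T.contract f s hs hroot hf).depth ≤ T.depth := by
  refine Finset.sup_le fun p _ => ?_
  have hsub : {q | (T.contract f s hs hroot hf).weakAncestor q p} ⊆
      f '' {u | T.weakAncestor u (s p)} := by
    rintro _ ⟨k, rfl⟩
    induction k with
    | zero => exact ⟨s p, ⟨0, rfl⟩, hs p⟩
    | succ k ih =>
      obtain ⟨_, ⟨j, rfl⟩, hj⟩ := ih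
      obtain ⟨i, hi⟩ := hanc (T.parent^[j] (s p))
      refine ⟨T.parent^[1 + i + j] (s p), ⟨_, rfl⟩, ?_⟩
      rw [Function.iterate_succ_apply', ← hj, Function.iterate_add_apply,
        Function.iterate_add_apply, hi]
      rfl
  calc _ ≤ (f '' {u | T.weakAncestor u (s p)}).ncard := Set.ncard_le_ncard hsub (Set.toFinite _)
    _ ≤ {u | T.weakAncestor u (s p)}.ncard := Set.ncard_image_le (Set.toFinite _)
    _ ≤ T.depth := Finset.le_sup (f := fun v => {u | T.weakAncestor u v}.ncard)
        (Finset.mem_univ (s p))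

end RTree

theorem stmt12 {V : Type*} [Fintype V] [DecidableEq V]
    (R : RTree V) (d : ℕ)
    (hchild : ∀ v : V,
      (Finset.univ.filter fun u => R.parent u = v ∧ u ≠ v).card ≤ d)
    (w : V → ℝ) (τ : ℝ)
    (hw : ∀ v : V, 0 < w v ∧ w v ≤ τ) :
    ∃ (P : Type) (_ : Fintype P) (_ : DecidableEq P) (f : V → P) (R' : RTree P),
      Function.Surjective f ∧
      (∀ p : P, ∃ t : V, f t = p ∧ ∀ u : V, f u = p →
        ∃ k : ℕ, R.parent^[k] u = t ∧ ∀ j ≤ k, f (R.parent^[j] u) = p) ∧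
      R'.root = f R.root ∧
      (∀ u : V, f (R.parent u) = f u ∨ R'.parent (f u) = f (R.parent u)) ∧
      R'.depth ≤ R.depth ∧
      (∀ p : P, ∑ u ∈ Finset.univ.filter (fun u => f u = p), w u ≤ ((d : ℝ) + 1) * τ) ∧
      (∀ p : P, p ≠ f R.root →
        τ ≤ ∑ u ∈ Finset.univ.filter (fun u => f u = p), w u) ∧
      (Fintype.card P : ℝ) ≤ (∑ v : V, w v) / τ + 1 := by
  classical
  have hτ : 0 < τ := (hw R.root).1.trans_le (hw R.root).2
  obtain ⟨r, hr⟩ := R.exists_residual_weight w τ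
  let N : V → Prop := fun v => r v < τ
  let _ : DecidablePred N := fun v => inferInstanceAs (Decidable (r v < τ))
  let e := Fintype.equivFin {v // R.head N v = v}
  let f : V → Fin (Fintype.card {v // R.head N v = v}) := fun v => e ⟨R.head N v, R.head_head N v⟩
  let s : Fin (Fintype.card {v // R.head N v = v}) → V := fun p => (e.symm p).1
  have hhead (p) : R.head N (s p) = s p := (e.symm p).2
  have hsf (v) : s (f v) = R.head N v := by simp [s, f]
  have hfs (p) : f (s p) = p := by
    simp only [f, hhead]
    exact e.apply_symm_apply p
  have hfeq (u p) : f u = p ↔ R.head N u = s p := by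
    constructor
    · rintro rfl
      exact (hsf u).symm
    · intro h
      rw [← hfs p]
      simp only [f, h, hhead]
  have hroot : s (f R.root) = R.root := by rw [hsf, R.head_root]
  have hf (u) : f (R.parent u) = f u ∨ s (f u) = u := by
    by_cases h : u ≠ R.root ∧ N u
    · exact Or.inl ((hfeq _ _).2 (by rw [hsf, R.head_of_pos h]))
    · exact Or.inr (by rw [hsf, R.head_of_neg h])
  have hweight (p) : ∑ u with f u = p, w u = r (s p) := by
    simp only [hfeq]
    convert R.sum_head_eq N hr (hhead p)
  have hlower (p) (hp : p ≠ f R.root) : τ ≤ ∑ u with f u = p, w u := by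
    rw [hweight]
    by_contra! h
    refine R.not_head N (s p) ?_
    rw [hhead]
    refine ⟨fun h' => hp ?_, h⟩
    rw [← h', hfs]
  refine ⟨_, inferInstance, inferInstance, f, R.contract f s hfs hroot hf,
    fun p => ⟨s p, hfs p⟩, fun p => ⟨s p, hfs p, fun u hu => ?_⟩, rfl, fun u => ?_,
    R.depth_contract_le f s hfs hroot hf fun u => ?_, fun p => ?_, ?_, ?_⟩
  · obtain ⟨k, hk, hj⟩ := R.exists_iterate_eq_head N u
    have hu' := (hfeq u p).1 hu
    exact ⟨k, hk.trans hu', fun j hjk => (hfeq _ _).2 ((hj j hjk).trans hu')⟩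
  · refine (hf u).imp_right fun h => ?_
    change f (R.parent (s (f u))) = _
    rw [h]
  · obtain ⟨k, hk, -⟩ := R.exists_iterate_eq_head N u
    exact ⟨k, hk.trans (hsf u).symm⟩
  · convert (hweight p).trans_le ?_
    rw [hr, add_comm, add_one_mul]
    refine add_le_add ?_ (hw (s p)).2
    refine (Finset.sum_le_card_nsmul _ r τ fun c hc => (Finset.mem_filter.1 hc).2.2.2.le).trans ?_
    rw [nsmul_eq_mul]
    refine mul_le_mul_of_nonneg_right (Nat.cast_le.2 ?_) hτ.le
    refine (Finset.card_le_card fun c hc => ?_).trans (hchild (s p))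
    simp only [Finset.mem_filter, Finset.mem_univ, true_and] at hc ⊢
    exact ⟨hc.1, fun h => R.parent_ne_self hc.2.1 (hc.1.trans h.symm)⟩
  · intro p hp
    convert hlower p hp
  · rw [← sub_le_iff_le_add, le_div_iff₀ hτ, ← Finset.sum_fiberwise Finset.univ f w,
      ← Finset.add_sum_erase _ _ (Finset.mem_univ (f R.root))]
    have h₀ : 0 ≤ ∑ u with f u = f R.root, w u := Finset.sum_nonneg fun u _ => (hw u).1.le
    have h₁ := Finset.card_nsmul_le_sum (Finset.univ.erase (f R.root))
      (fun p => ∑ u with f u = p, w u) τ fun p hp => hlower p (Finset.ne_of_mem_erase hp)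
    rw [nsmul_eq_mul, Finset.card_erase_of_mem (Finset.mem_univ _), Finset.card_univ,
      Nat.cast_pred (Fintype.card_pos_iff.2 ⟨f R.root⟩)] at h₁
    linarith
end

section
/- Let (T,(J_t)_{t∈[n]}) be a tree decomposition of a finite simple graph in which the tree T has maximum degree at most 3 and every bag satisfies |J_t| ≤ τ. Consider a finite set of constraints of two types: type-A constraints, each assigned to a single tree vertex j ∈ [n], with at most τ² type-A constraints assigned to each tree vertex; and type-N constraints, each assigned to an edge {i,j} of T, with at most τ² type-N constraints assigned to each edge. Say that a constraint involves a tree vertex t if it is a type-A constraint assigned to t, or a type-N constraint assigned to an edge incident to t. Let H be the graph whose vertices are the constraints, with two constraints adjacent if and only if they involve a common tree vertex. Then H admits a tree decomposition whose underlying tree is T and in which every bag has size at most 7τ². -/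
/-- If each edge of `T` carries at most `m` labels, then the number of labels on edges at `t` is at
most `m` times the degree of `t`. -/
theorem card_labels_at_vertex_le {ι C : Type*} [Fintype ι] [DecidableEq ι] [Fintype C]
    (T : SimpleGraph ι) (a : C → Sym2 ι) (ha : ∀ c, a c ∈ T.edgeSet) {m : ℕ}
    (hm : ∀ e ∈ T.edgeSet, (Finset.univ.filter fun c => a c = e).card ≤ m) (t : ι) :
    (Finset.univ.filter fun c => t ∈ a c).card ≤ m * (T.neighborSet t).ncard := by
  classical
  rw [Set.ncard_eq_toFinset_card']
  set s := Finset.univ.filter fun c => t ∈ a c with hs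
  have himage : s.image a ⊆ (T.neighborSet t).toFinset.image fun u => s(t, u) := by
    intro e he
    obtain ⟨c, hc, rfl⟩ := Finset.mem_image.mp he
    obtain ⟨u, hu⟩ : ∃ u, a c = s(t, u) := Sym2.mem_iff_exists.mp (Finset.mem_filter.mp hc).2
    have hadj := ha c
    rw [hu, SimpleGraph.mem_edgeSet] at hadj
    exact Finset.mem_image.mpr ⟨u, by simpa using hadj, hu.symm⟩
  calc s.card ≤ m * (s.image a).card := by
        refine Finset.card_le_mul_card_image s m fun e he => ?_
        obtain ⟨c, -, rfl⟩ := Finset.mem_image.mp he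
        exact (Finset.card_le_card (Finset.filter_subset_filter _ (Finset.subset_univ s))).trans
          (hm _ (ha c))
    _ ≤ m * (T.neighborSet t).toFinset.card :=
        Nat.mul_le_mul_left m ((Finset.card_le_card himage).trans Finset.card_image_le)

/-- The endpoints of an edge induce a connected subgraph. -/
theorem induce_endpoints_connected {ι : Type*} (T : SimpleGraph ι) {e : Sym2 ι}
    (he : e ∈ T.edgeSet) : (T.induce {t | t ∈ e}).Connected := by
  induction e with
  | _ i j =>
    have hset : {t | t ∈ s(i, j)} = ({i, j} : Set ι) := by ext; simp
    rw [hset]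
    exact SimpleGraph.induce_pair_connected_of_adj he

theorem stmt13 {V : Type*} {n τ : ℕ}
    (G : SimpleGraph V) (T : SimpleGraph (Fin n)) (J : Fin n → Finset V)
    (hTD : IsTreeDecomp G T J)
    (hdeg : ∀ t : Fin n, (T.neighborSet t).ncard ≤ 3)
    (hbag : ∀ t : Fin n, (J t).card ≤ τ)
    (CA CN : Type*) [Fintype CA] [Fintype CN]
    (aA : CA → Fin n)
    (hA : ∀ t : Fin n, (Finset.univ.filter fun c => aA c = t).card ≤ τ ^ 2)
    (aN : CN → Sym2 (Fin n))
    (haN : ∀ c : CN, aN c ∈ T.edgeSet)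
    (hN : ∀ e ∈ T.edgeSet, (Finset.univ.filter fun c => aN c = e).card ≤ τ ^ 2)
    (H : SimpleGraph (CA ⊕ CN))
    (hH : ∀ x y : CA ⊕ CN, H.Adj x y ↔ x ≠ y ∧ ∃ t : Fin n,
      Sum.elim (fun c => aA c = t) (fun c => t ∈ aN c) x ∧
      Sum.elim (fun c => aA c = t) (fun c => t ∈ aN c) y) :
    ∃ J' : Fin n → Finset (CA ⊕ CN),
      IsTreeDecomp H T J' ∧ ∀ t : Fin n, (J' t).card ≤ 7 * τ ^ 2 := by
  classical
  refine ⟨fun t => (Finset.univ.filter fun c => aA c = t).disjSum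
    (Finset.univ.filter fun c => t ∈ aN c), ⟨hTD.1, fun x y hxy => ?_, ?_⟩, fun t => ?_⟩
  · obtain ⟨-, t, hx, hy⟩ := (hH x y).mp hxy
    refine ⟨t, ?_, ?_⟩
    · cases x <;> simpa using hx
    · cases y <;> simpa using hy
  · rintro (c | c)
    · have hset : {t | Sum.inl c ∈ (Finset.univ.filter fun c => aA c = t).disjSum
          (Finset.univ.filter fun c => t ∈ aN c)} = {aA c} := by ext; simp [eq_comm]
      rw [hset]
      exact SimpleGraph.connected_iff_exists_forall_reachable _ |>.mpr
        ⟨⟨aA c, rfl⟩, fun v => by rw [Subsingleton.elim v ⟨aA c, rfl⟩]⟩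
    · have hset : {t | Sum.inr c ∈ (Finset.univ.filter fun c => aA c = t).disjSum
          (Finset.univ.filter fun c => t ∈ aN c)} = {t | t ∈ aN c} := by ext; simp
      rw [hset]
      exact induce_endpoints_connected T (haN c)
  · rw [Finset.card_disjSum]
    have hcard := card_labels_at_vertex_le T aN haN hN t
    have hthree := Nat.mul_le_mul_left (τ ^ 2) (hdeg t)
    have hsingle := hA t
    lia
end

section
/- Let (T,(J_t)_{t∈[n]}) be a tree decomposition of a finite simple graph in which the tree T has maximum degree at most 3 and every bag satisfies |J_t| ≤ τ. Consider a finite set of constraints of two types: type-A constraints, where each type-A constraint c is assigned a nonempty set S_c ⊆ [n] of tree vertices inducing a connected subtree of T, and let γ := max_{t∈[n]} #{type-A constraints c : t ∈ S_c}; and type-N constraints, each assigned to an edge {i,j} of T, with at most τ² type-N constraints assigned to each edge. Say that a type-A constraint c involves a tree vertex t if t ∈ S_c, and a type-N constraint assigned to {i,j} involves exactly i and j. Let H be the graph whose vertices are the constraints, with two constraints adjacent if and only if they involve a common tree vertex. Then H admits a tree decomposition whose underlying tree is T and in which every bag has size at most γ + 3τ². -/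
/-- The two endpoints of an edge induce a connected subgraph. -/
lemma SimpleGraph.induce_edge_connected {V : Type*} (G : SimpleGraph V) {e : Sym2 V}
    (he : e ∈ G.edgeSet) : (G.induce {t : V | t ∈ e}).Connected := by
  induction e using Sym2.ind with
  | _ i j =>
    have hs : {t : V | t ∈ s(i, j)} = {i, j} := by
      ext t
      simp
    rw [hs]
    exact SimpleGraph.induce_pair_connected_of_adj he

/-- If every edge of `T` carries at most `m` labels and `t` has at most `d` neighbours, then at
most `d * m` labels lie on edges incident to `t`. -/
lemma SimpleGraph.card_filter_mem_edge_le {V C : Type*} [Fintype V] [DecidableEq V] [Fintype C]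
    (T : SimpleGraph V) {d m : ℕ} (a : C → Sym2 V) (ha : ∀ c, a c ∈ T.edgeSet)
    (hm : ∀ e ∈ T.edgeSet, (Finset.univ.filter fun c => a c = e).card ≤ m)
    (t : V) (hd : (T.neighborSet t).ncard ≤ d) :
    (Finset.univ.filter fun c => t ∈ a c).card ≤ d * m := by
  classical
  have hsub : (Finset.univ.filter fun c => t ∈ a c) ⊆
      (T.neighborFinset t).biUnion fun u => Finset.univ.filter fun c => a c = s(t, u) := by
    intro c hc
    obtain ⟨u, hu⟩ := (Finset.mem_filter.mp hc).2
    have hadj : T.Adj t u := by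
      have := ha c
      rwa [hu] at this
    simp only [Finset.mem_biUnion, Finset.mem_filter, Finset.mem_univ, true_and]
    exact ⟨u, by simpa using hadj, hu⟩
  have hdeg : (T.neighborFinset t).card ≤ d := by
    rwa [← Set.ncard_coe_finset, SimpleGraph.coe_neighborFinset]
  calc _ ≤ _ := Finset.card_le_card hsub
    _ ≤ (T.neighborFinset t).card * m :=
      Finset.card_biUnion_le_card_mul _ _ _ fun u hu => hm _ (by simpa using hu)
    _ ≤ d * m := Nat.mul_le_mul_right m hdeg

theorem stmt14 {V : Type*} {n τ : ℕ}
    (G : SimpleGraph V) (T : SimpleGraph (Fin n)) (J : Fin n → Finset V)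
    (hTD : IsTreeDecomp G T J)
    (hdeg : ∀ t : Fin n, (T.neighborSet t).ncard ≤ 3)
    (hbag : ∀ t : Fin n, (J t).card ≤ τ)
    (CA CN : Type*) [Fintype CA] [Fintype CN]
    (SA : CA → Finset (Fin n))
    (hSAne : ∀ c : CA, (SA c).Nonempty)
    (hSAconn : ∀ c : CA, (T.induce {t : Fin n | t ∈ SA c}).Connected)
    (aN : CN → Sym2 (Fin n))
    (haN : ∀ c : CN, aN c ∈ T.edgeSet)
    (hN : ∀ e ∈ T.edgeSet, (Finset.univ.filter fun c => aN c = e).card ≤ τ ^ 2)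
    (H : SimpleGraph (CA ⊕ CN))
    (hH : ∀ x y : CA ⊕ CN, H.Adj x y ↔ x ≠ y ∧ ∃ t : Fin n,
      Sum.elim (fun c => t ∈ SA c) (fun c => t ∈ aN c) x ∧
      Sum.elim (fun c => t ∈ SA c) (fun c => t ∈ aN c) y) :
    ∃ J' : Fin n → Finset (CA ⊕ CN),
      IsTreeDecomp H T J' ∧ ∀ t : Fin n,
        (J' t).card ≤
          (Finset.univ.sup fun t' : Fin n =>
            (Finset.univ.filter fun c : CA => t' ∈ SA c).card) + 3 * τ ^ 2 := by
  refine ⟨fun t => (Finset.univ.filter fun c => t ∈ SA c).disjSum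
    (Finset.univ.filter fun c => t ∈ aN c), ⟨hTD.1, ?_, ?_⟩, fun t => ?_⟩
  · intro x y hxy
    obtain ⟨-, t, hx, hy⟩ := (hH x y).mp hxy
    refine ⟨t, ?_, ?_⟩
    · cases x <;> simpa using hx
    · cases y <;> simpa using hy
  · rintro (c | c)
    · convert hSAconn c using 3
      all_goals simp
    · convert T.induce_edge_connected (haN c) using 3
      all_goals simp
  · rw [Finset.card_disjSum]
    exact Nat.add_le_add
      (Finset.le_sup (f := fun t' : Fin n => (Finset.univ.filter fun c : CA => t' ∈ SA c).card)
        (Finset.mem_univ t))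
      (T.card_filter_mem_edge_le aN haN hN t (hdeg t))
end
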